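/- arXiv:1512.08423 — 5 statements merged into one kernel-verified Lean document; each statement's English description precedes it below -/
import Mathlib

section
/- Let M be an (n+1)×(n+1) real symmetric matrix written in block form M = [[a, b], [bᵀ, M′]], where a ∈ ℝ, b is a 1×n row vector, and M′ is an n×n real symmetric matrix. Then for every τ ∈ ℂ, det([[τ + ia, ib], [ibᵀ, I_n + iM′]]) = det(I_{n+1} + iM) − (1 − τ)·det(I_n + iM′). -/
/-- The determinant of a block matrix is affine in its scalar top-left entry, with slope the
determinant of the bottom-right block. -/
theorem Matrix.det_fromBlocks_unit_add {R m : Type*} [CommRing R] [Fintype m] [DecidableEq m]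
    (x y : R) (B : Matrix Unit m R) (C : Matrix m Unit R) (D : Matrix m m R) :
    (fromBlocks (of fun (_ : Unit) (_ : Unit) => x + y) B C D).det
      = (fromBlocks (of fun (_ : Unit) (_ : Unit) => x) B C D).det + y * D.det := by
  have update (z : R) (B' : Matrix Unit m R) :
      (fromBlocks (of fun (_ : Unit) (_ : Unit) => x) B C D).updateRow (Sum.inl ())
        (Sum.elim (fun _ => z) (B' ())) =
      fromBlocks (of fun (_ : Unit) (_ : Unit) => z) B' C D := by
    ext (i | i) (j | j) <;> simp [updateRow_apply]
  have row : (Sum.elim (fun _ => x + y) (B ()) : Unit ⊕ m → R) =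
      Sum.elim (fun _ => x) (B ()) + Sum.elim (fun _ => y) ((0 : Matrix Unit m R) ()) := by
    ext (j | j) <;> simp
  rw [← update (x + y) B, row, det_updateRow_add, update, update, det_fromBlocks_zero₁₂]
  simp

/-- Let `M = [[a, b], [bᵀ, M']]` be an `(n+1) × (n+1)` real symmetric
matrix in block form (`a ∈ ℝ`, `b` a row vector, `M'` an `n × n` real symmetric matrix).
Then for every `τ ∈ ℂ`,
`det [[τ + i a, i b], [i bᵀ, I_n + i M']] = det (I_{n+1} + i M) - (1 - τ) · det (I_n + i M')`. -/
theorem stmt4 {n : ℕ} (a : ℝ) (b : Fin n → ℝ) (M' : Matrix (Fin n) (Fin n) ℝ)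
    (hM' : M'.IsSymm) (τ : ℂ) :
    (Matrix.fromBlocks
        (Matrix.of fun (_ : Unit) (_ : Unit) => τ + Complex.I * (a : ℂ))
        (Matrix.of fun (_ : Unit) j => Complex.I * (b j : ℂ))
        (Matrix.of fun i (_ : Unit) => Complex.I * (b i : ℂ))
        (1 + Complex.I • M'.map Complex.ofReal)).det
      = (1 + Complex.I • (Matrix.fromBlocks
            (Matrix.of fun (_ : Unit) (_ : Unit) => a)
            (Matrix.of fun (_ : Unit) j => b j)
            (Matrix.of fun i (_ : Unit) => b i)
            M').map Complex.ofReal).det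
        - (1 - τ) * (1 + Complex.I • M'.map Complex.ofReal).det := by
  have shift : τ + Complex.I * (a : ℂ) = (1 + Complex.I * (a : ℂ)) + (τ - 1) := by ring
  rw [shift, Matrix.det_fromBlocks_unit_add]
  have blocks : (1 + Complex.I • (Matrix.fromBlocks
            (Matrix.of fun (_ : Unit) (_ : Unit) => a)
            (Matrix.of fun (_ : Unit) j => b j)
            (Matrix.of fun i (_ : Unit) => b i)
            M').map Complex.ofReal) =
      Matrix.fromBlocks
        (Matrix.of fun (_ : Unit) (_ : Unit) => 1 + Complex.I * (a : ℂ))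
        (Matrix.of fun (_ : Unit) j => Complex.I * (b j : ℂ))
        (Matrix.of fun i (_ : Unit) => Complex.I * (b i : ℂ))
        (1 + Complex.I • M'.map Complex.ofReal) := by
    ext (i | i) (j | j) <;> simp [Matrix.one_apply]
  rw [blocks]
  ring
end

section
/- Let M be an (n+1)×(n+1) real symmetric matrix written in block form M = [[a, b], [bᵀ, M′]], where a ∈ ℝ, b is a 1×n row vector, and M′ is an n×n real symmetric matrix, and let θ ∈ ℝ. Then Im(e^{−iθ} det([[ia, ib], [ibᵀ, I_n + iM′]])) = (cos θ · ∑_{2k+1 ≤ n+1} (−1)^k σ_{2k+1}(M) − sin θ · ∑_{2k ≤ n+1} (−1)^k σ_{2k}(M)) − (cos θ · ∑_{2k+1 ≤ n} (−1)^k σ_{2k+1}(M′) − sin θ · ∑_{2k ≤ n} (−1)^k σ_{2k}(M′)). -/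
/-- The `k`-th elementary symmetric polynomial of the eigenvalues (listed with
multiplicity) of a real symmetric matrix; `0` if the matrix is not symmetric. -/
noncomputable def esymmEig {ι : Type*} [Fintype ι] [DecidableEq ι]
    (M : Matrix ι ι ℝ) (k : ℕ) : ℝ :=
  if h : M.IsHermitian then
    ∑ t ∈ Finset.univ.powersetCard k, ∏ j ∈ t, h.eigenvalues j
  else 0

/-- The `(n+1) × (n+1)` real symmetric matrix `[[a, b], [bᵀ, M']]` in block form. -/
def borderedMat {n : ℕ} (a : ℝ) (b : Fin n → ℝ) (M' : Matrix (Fin n) (Fin n) ℝ) :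
    Matrix (Unit ⊕ Fin n) (Unit ⊕ Fin n) ℝ :=
  Matrix.fromBlocks
    (Matrix.of fun (_ : Unit) (_ : Unit) => a)
    (Matrix.of fun (_ : Unit) j => b j)
    (Matrix.of fun i (_ : Unit) => b i)
    M'

open Complex in
/-- The complexified characteristic identity `det (1 + i A) = ∑ k, i ^ k σ_k(A)`. -/
theorem det_one_add_I_smul {ι : Type*} [Fintype ι] [DecidableEq ι] (A : Matrix ι ι ℝ)
    (hA : A.IsHermitian) :
    (1 + I • A.map ofReal).det =
      ∑ k ∈ Finset.range (Fintype.card ι + 1), I ^ k * (esymmEig A k : ℂ) := by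
  have hchar : (A.map ofReal).charpoly =
      ∏ i, (Polynomial.X - Polynomial.C ((hA.eigenvalues i : ℝ) : ℂ)) := by
    change (A.map ofRealHom).charpoly = _
    rw [Matrix.charpoly_map, hA.charpoly_eq]
    simp [Polynomial.map_prod]
  have hmat : 1 + I • A.map ofReal = (-I) • (Matrix.scalar ι I - A.map ofReal) := by
    rw [smul_sub, Matrix.scalar_apply, ← Matrix.smul_one_eq_diagonal, smul_smul]
    simp
  have hdet : (1 + I • A.map ofReal).det = ∏ i, (1 + I * (hA.eigenvalues i : ℂ)) := by
    rw [hmat, Matrix.det_smul, ← Matrix.eval_charpoly, hchar, Polynomial.eval_prod,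
      ← Finset.card_univ, ← Finset.prod_const, ← Finset.prod_mul_distrib]
    refine Finset.prod_congr rfl fun i _ => ?_
    simp only [Polynomial.eval_sub, Polynomial.eval_X, Polynomial.eval_C]
    linear_combination -I_mul_I
  rw [hdet, Finset.prod_one_add, Finset.sum_powerset, Finset.card_univ]
  refine Finset.sum_congr rfl fun k _ => ?_
  simp only [esymmEig, dif_pos hA, ofReal_sum, ofReal_prod, Finset.mul_sum]
  refine Finset.sum_congr rfl fun t ht => ?_
  rw [Finset.prod_mul_distrib, Finset.prod_const, (Finset.mem_powersetCard.mp ht).2]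

open Complex in
/-- Splitting a polynomial sum in `i` into its real and imaginary parts. -/
theorem sum_I_pow_mul_ofReal (s : ℕ → ℝ) (m : ℕ) :
    ∑ k ∈ Finset.range (m + 1), I ^ k * (s k : ℂ) =
      ((∑ k ∈ Finset.range (m / 2 + 1), (-1 : ℝ) ^ k * s (2 * k) : ℝ) : ℂ) +
        I * ((∑ k ∈ Finset.range ((m + 1) / 2), (-1 : ℝ) ^ k * s (2 * k + 1) : ℝ) : ℂ) := by
  induction m with
  | zero => simp
  | succ m ih =>
    rw [Finset.sum_range_succ, ih]
    obtain ⟨j, rfl | rfl⟩ := Nat.even_or_odd' m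
    · rw [show 2 * j / 2 = j by lia, show (2 * j + 1) / 2 = j by lia,
        show (2 * j + 1 + 1) / 2 = j + 1 by lia, Finset.sum_range_succ _ j,
        Finset.sum_range_succ _ j, pow_succ, pow_mul, I_sq]
      push_cast
      ring
    · rw [show (2 * j + 1) / 2 = j by lia, show (2 * j + 1 + 1) / 2 = j + 1 by lia,
        show (2 * j + 1 + 1 + 1) / 2 = j + 1 by lia, Finset.sum_range_succ _ (j + 1),
        show 2 * j + 1 + 1 = 2 * (j + 1) by ring, pow_mul, I_sq]
      push_cast
      ring

/-- Adding `1` to a scalar top-left block adds the complementary minor to the determinant. -/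
theorem det_fromBlocks_one_add {R ι : Type*} [CommRing R] [Fintype ι] [DecidableEq ι]
    (A : Matrix Unit Unit R) (B : Matrix Unit ι R) (C : Matrix ι Unit R) (D : Matrix ι ι R) :
    (Matrix.fromBlocks (1 + A) B C D).det = D.det + (Matrix.fromBlocks A B C D).det := by
  have h := Matrix.det_updateRow_add (Matrix.fromBlocks A B C D) (Sum.inl ())
    (Sum.elim 1 0) (Sum.elim (A ()) (B ()))
  have h₀ : (Matrix.fromBlocks A B C D).updateRow (Sum.inl ())
      ((Sum.elim 1 0 : Unit ⊕ ι → R) + Sum.elim (A ()) (B ())) = Matrix.fromBlocks (1 + A) B C D := by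
    ext (i | i) (j | j) <;> simp [Matrix.updateRow_apply]
  have h₁ : (Matrix.fromBlocks A B C D).updateRow (Sum.inl ()) (Sum.elim 1 0) =
      Matrix.fromBlocks 1 0 C D := by
    ext (i | i) (j | j) <;> simp [Matrix.updateRow_apply]
  have h₂ : (Matrix.fromBlocks A B C D).updateRow (Sum.inl ()) (Sum.elim (A ()) (B ())) =
      Matrix.fromBlocks A B C D := by
    ext (i | i) (j | j) <;> simp [Matrix.updateRow_apply]
  rw [h₀, h₁, h₂, Matrix.det_fromBlocks_zero₁₂] at h
  simpa using h

/-- For `M = [[a, b], [bᵀ, M']]` an `(n+1) × (n+1)` real symmetric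
matrix in block form and `θ ∈ ℝ`,
`Im (e^{-iθ} det [[i a, i b], [i bᵀ, I_n + i M']])
  = (cos θ · ∑_{2k+1 ≤ n+1} (-1)^k σ_{2k+1}(M) - sin θ · ∑_{2k ≤ n+1} (-1)^k σ_{2k}(M))
  - (cos θ · ∑_{2k+1 ≤ n} (-1)^k σ_{2k+1}(M') - sin θ · ∑_{2k ≤ n} (-1)^k σ_{2k}(M'))`. -/
theorem stmt5 {n : ℕ} (a : ℝ) (b : Fin n → ℝ) (M' : Matrix (Fin n) (Fin n) ℝ)
    (hM' : M'.IsSymm) (θ : ℝ) :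
    (Complex.exp (-(Complex.I * (θ : ℂ))) *
        (Matrix.fromBlocks
          (Matrix.of fun (_ : Unit) (_ : Unit) => Complex.I * (a : ℂ))
          (Matrix.of fun (_ : Unit) j => Complex.I * (b j : ℂ))
          (Matrix.of fun i (_ : Unit) => Complex.I * (b i : ℂ))
          (1 + Complex.I • M'.map Complex.ofReal)).det).im
      = (Real.cos θ * ∑ k ∈ Finset.range ((n + 2) / 2),
            (-1 : ℝ) ^ k * esymmEig (borderedMat a b M') (2 * k + 1)
          - Real.sin θ * ∑ k ∈ Finset.range ((n + 1) / 2 + 1),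
            (-1 : ℝ) ^ k * esymmEig (borderedMat a b M') (2 * k))
        - (Real.cos θ * ∑ k ∈ Finset.range ((n + 1) / 2),
              (-1 : ℝ) ^ k * esymmEig M' (2 * k + 1)
            - Real.sin θ * ∑ k ∈ Finset.range (n / 2 + 1),
              (-1 : ℝ) ^ k * esymmEig M' (2 * k)) := by
  have hM'H : M'.IsHermitian := by
    rw [Matrix.IsHermitian, Matrix.conjTranspose_eq_transpose_of_trivial]
    exact hM'
  have hM : (borderedMat a b M').IsHermitian := by
    refine Matrix.IsHermitian.fromBlocks (by ext; simp) (by ext; simp) hM'H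
  have hblock := det_fromBlocks_one_add
    (Matrix.of fun (_ : Unit) (_ : Unit) => Complex.I * (a : ℂ))
    (Matrix.of fun (_ : Unit) j => Complex.I * (b j : ℂ))
    (Matrix.of fun i (_ : Unit) => Complex.I * (b i : ℂ))
    (1 + Complex.I • M'.map Complex.ofReal)
  have hbig : Matrix.fromBlocks
      (1 + Matrix.of fun (_ : Unit) (_ : Unit) => Complex.I * (a : ℂ))
      (Matrix.of fun (_ : Unit) j => Complex.I * (b j : ℂ))
      (Matrix.of fun i (_ : Unit) => Complex.I * (b i : ℂ))
      (1 + Complex.I • M'.map Complex.ofReal) =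
      1 + Complex.I • (borderedMat a b M').map Complex.ofReal := by
    ext (i | i) (j | j) <;> simp [borderedMat, Matrix.one_apply]
  have hcard : Fintype.card (Unit ⊕ Fin n) = n + 1 := by simp [add_comm]
  rw [hbig, det_one_add_I_smul _ hM, det_one_add_I_smul _ hM'H, sum_I_pow_mul_ofReal,
    sum_I_pow_mul_ofReal, hcard, Fintype.card_fin] at hblock
  rw [← sub_eq_iff_eq_add'.mpr hblock,
    show -(Complex.I * (θ : ℂ)) = ((-θ : ℝ) : ℂ) * Complex.I by push_cast; ring,
    Complex.exp_mul_I, ← Complex.ofReal_cos, ← Complex.ofReal_sin, Real.cos_neg, Real.sin_neg]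
  simp only [Complex.mul_im, Complex.mul_re, Complex.add_im, Complex.add_re, Complex.sub_im,
    Complex.sub_re, Complex.ofReal_re, Complex.ofReal_im, Complex.I_re, Complex.I_im]
  ring
end

section
/- Fix λ′_1, …, λ′_n ∈ ℝ and C > 0. There exists a constant C₂ > 0, depending only on λ′_1, …, λ′_n and C, such that for every ε > 0 there exists R > 0 with the following property: for every a ∈ ℝ with |a| ≥ R and every a_1, …, a_n ∈ ℝ with |a_j| ≤ C for all j, the (n+1)×(n+1) symmetric matrix A with A_{00} = a, A_{0j} = A_{j0} = a_j, A_{jj} = λ′_j and all other entries zero has its eigenvalues (with multiplicity) enumerable as μ_1, …, μ_n, μ_{n+1} with |μ_j − λ′_j| ≤ ε for 1 ≤ j ≤ n and |μ_{n+1} − a| ≤ C₂. -/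
/-- If the rows of a near-identity matrix `U` are approximate left eigenvectors of a real symmetric
matrix `A` with approximate eigenvalues `d i` and errors small relative to `δ i`, then the
eigenvalues of `A` can be enumerated so that the `i`-th one is within `δ i` of `d i`. -/
theorem Matrix.IsHermitian.exists_perm_abs_eigenvalues_sub_le {ι : Type*} [Fintype ι]
    [DecidableEq ι] {A : Matrix ι ι ℝ} (hA : A.IsHermitian) (U : Matrix ι ι ℝ) (d δ : ι → ℝ)
    (hδ : ∀ i, 0 < δ i)
    (hU : ∀ i j, |U i j - (1 : Matrix ι ι ℝ) i j| ≤ 1 / (8 * (Fintype.card ι : ℝ)))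
    (hR : ∀ i j, |(U * A) i j - d i * U i j| ≤ δ i / (8 * (Fintype.card ι : ℝ) ^ 3)) :
    ∃ e : Equiv.Perm ι, ∀ i, |hA.eigenvalues (e i) - d i| ≤ δ i := by
  classical
  rcases isEmpty_or_nonempty ι with h_empty | h_nonempty
  · exact ⟨1, fun i => h_empty.elim i⟩
  set N : ℝ := (Fintype.card ι : ℝ) with hN
  have hN1 : 1 ≤ N := by
    rw [hN]
    exact_mod_cast Fintype.card_pos (α := ι)
  have hN0 : 0 < N := by linarith
  set W : Matrix ι ι ℝ := (hA.eigenvectorUnitary : Matrix ι ι ℝ) with hW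
  have hWW : W * star W = 1 := Unitary.coe_mul_star_self hA.eigenvectorUnitary
  have hWW' : star W * W = 1 := Unitary.coe_star_mul_self hA.eigenvectorUnitary
  have hWle : ∀ i j, |W i j| ≤ 1 := fun i j =>
    entry_norm_bound_of_unitary hA.eigenvectorUnitary.2 i j
  have hAW : A * W = W * Matrix.diagonal hA.eigenvalues := by
    have h := hA.spectral_theorem
    rw [Unitary.conjStarAlgAut_apply] at h
    conv_lhs => rw [h]
    rw [Matrix.mul_assoc, hWW', Matrix.mul_one]
    rfl
  have hentry : ∀ i k, (U * W) i k * (hA.eigenvalues k - d i)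
      = ∑ l, ((U * A) i l - d i * U i l) * W l k := by
    intro i k
    have h : (U * W) i k * hA.eigenvalues k = (U * A * W) i k := by
      rw [Matrix.mul_assoc, hAW, ← Matrix.mul_assoc, Matrix.mul_diagonal]
    rw [mul_sub, h]
    simp only [sub_mul, Finset.sum_sub_distrib, Matrix.mul_apply, mul_comm _ (d i), mul_assoc,
      Finset.mul_sum]
  have hsmall : ∀ i k, δ i < |hA.eigenvalues k - d i| → |(U * W) i k| ≤ 1 / (8 * N ^ 2) := by
    intro i k hik
    have h : |(U * W) i k| * |hA.eigenvalues k - d i| ≤ N * (δ i / (8 * N ^ 3)) := by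
      rw [← abs_mul, hentry]
      refine (Finset.abs_sum_le_sum_abs _ _).trans ?_
      refine (Finset.sum_le_card_nsmul _ _ (δ i / (8 * N ^ 3)) fun l _ => ?_).trans_eq ?_
      · rw [abs_mul]
        exact (mul_le_of_le_one_right (abs_nonneg _) (hWle l k)).trans (hR i l)
      · simp [hN]
    have h' : |(U * W) i k| * δ i ≤ 1 / (8 * N ^ 2) * δ i := by
      refine (mul_le_mul_of_nonneg_left hik.le (abs_nonneg _)).trans (h.trans_eq ?_)
      field_simp
    exact le_of_mul_le_mul_right h' (hδ i)
  set E : Matrix ι ι ℝ :=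
    Matrix.of fun i k => if |hA.eigenvalues k - d i| ≤ δ i then 0 else (U * W) i k with hE
  have hEle : ∀ i k, |E i k| ≤ 1 / (8 * N ^ 2) := by
    intro i k
    simp only [hE, Matrix.of_apply]
    split_ifs with h
    · simp only [abs_zero]
      positivity
    · exact hsmall i k (not_le.mp h)
  have hclose : ∀ i j, |(U - E * star W) i j - (1 : Matrix ι ι ℝ) i j| ≤ 1 / (4 * N) := by
    intro i j
    have h : |(E * star W) i j| ≤ 1 / (8 * N) := by
      rw [Matrix.mul_apply]
      refine (Finset.abs_sum_le_sum_abs _ _).trans ?_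
      refine (Finset.sum_le_card_nsmul _ _ (1 / (8 * N ^ 2)) fun l _ => ?_).trans_eq ?_
      · rw [abs_mul]
        refine (mul_le_of_le_one_right (abs_nonneg _) ?_).trans (hEle i l)
        simpa [Matrix.star_apply] using hWle j l
      · rw [Finset.card_univ, nsmul_eq_mul, ← hN]
        field_simp
    have h2 : 1 / (4 * N) = 1 / (8 * N) + 1 / (8 * N) := by
      field_simp
      norm_num
    rw [Matrix.sub_apply, sub_right_comm, h2]
    exact (abs_sub _ _).trans (add_le_add (hU i j) h)
  have hdet : (U - E * star W).det ≠ 0 := by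
    refine det_ne_zero_of_sum_row_lt_diag fun i => ?_
    have hoff : ∑ j ∈ Finset.univ.erase i, ‖(U - E * star W) i j‖ ≤ (N - 1) * (1 / (4 * N)) := by
      refine (Finset.sum_le_card_nsmul _ _ (1 / (4 * N)) fun j hj => ?_).trans_eq ?_
      · have h := hclose i j
        rwa [Matrix.one_apply_ne (Finset.ne_of_mem_erase hj).symm, sub_zero] at h
      · rw [Finset.card_erase_of_mem (Finset.mem_univ i), Finset.card_univ, nsmul_eq_mul,
          Nat.cast_pred Fintype.card_pos]
    have hdiag := (abs_le.mp (hclose i i)).1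
    rw [Matrix.one_apply_eq] at hdiag
    have hsum : (N - 1) * (1 / (4 * N)) + 1 / (4 * N) = 1 / 4 := by
      field_simp
      ring
    refine hoff.trans_lt (lt_of_lt_of_le ?_ (le_abs_self _))
    linarith
  have hdet' : (U * W - E).det ≠ 0 := by
    have h : (U * W - E) * star W = U - E * star W := by
      rw [Matrix.sub_mul, Matrix.mul_assoc, hWW, Matrix.mul_one]
    rw [← h, Matrix.det_mul] at hdet
    exact left_ne_zero_of_mul hdet
  rw [← Matrix.det_transpose, Matrix.det_apply] at hdet'
  obtain ⟨σ, -, hσ⟩ := Finset.exists_ne_zero_of_sum_ne_zero hdet'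
  refine ⟨σ, fun i => ?_⟩
  by_contra hi
  refine hσ ?_
  rw [Finset.prod_eq_zero (Finset.mem_univ i) _, smul_zero]
  simp [hE, hi]


/-- The `(n+1) × (n+1)` symmetric bordered matrix with corner entry `a`, border row/column
`aV`, diagonal lower-right block `diag d`, and all other entries zero. -/
def arrowMat {n : ℕ} (a : ℝ) (aV d : Fin n → ℝ) :
    Matrix (Unit ⊕ Fin n) (Unit ⊕ Fin n) ℝ :=
  Matrix.fromBlocks
    (Matrix.of fun (_ : Unit) (_ : Unit) => a)
    (Matrix.of fun (_ : Unit) j => aV j)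
    (Matrix.of fun i (_ : Unit) => aV i)
    (Matrix.diagonal d)

/-- (CNS eigenvalue asymptotics, part 1.) Fix `λ'_1, …, λ'_n ∈ ℝ` and
`C > 0`. There is `C₂ > 0` (depending only on the `λ'_j` and `C`) such that for every
`ε > 0` there is `R > 0` so that: whenever `|a| ≥ R` and `|a_j| ≤ C` for all `j`, the
eigenvalues of the symmetric arrow matrix with diagonal `(a, λ'_1, …, λ'_n)` and border
`(a_1, …, a_n)` can be enumerated as `μ_1, …, μ_n, μ_{n+1}` with `|μ_j - λ'_j| ≤ ε`
for `1 ≤ j ≤ n` and `|μ_{n+1} - a| ≤ C₂`. -/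
theorem stmt8 {n : ℕ} (lam : Fin n → ℝ) (C : ℝ) (hC : 0 < C) :
    ∃ C₂ > (0 : ℝ), ∀ ε > (0 : ℝ), ∃ R > (0 : ℝ),
      ∀ a : ℝ, R ≤ |a| → ∀ aV : Fin n → ℝ, (∀ j, |aV j| ≤ C) →
        ∀ hA : (arrowMat a aV lam).IsHermitian,
          ∃ e : Equiv.Perm (Unit ⊕ Fin n),
            (∀ j : Fin n, |hA.eigenvalues (e (Sum.inr j)) - lam j| ≤ ε) ∧
            |hA.eigenvalues (e (Sum.inl ())) - a| ≤ C₂ := by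
  set N : ℝ := (Fintype.card (Unit ⊕ Fin n) : ℝ) with hN
  have hN0 : 0 < N := by
    rw [hN]
    exact_mod_cast Fintype.card_pos
  set L : ℝ := ∑ j, |lam j| with hL
  have hL0 : 0 ≤ L := Finset.sum_nonneg fun j _ => abs_nonneg _
  have hlam : ∀ j, |lam j| ≤ L := fun j =>
    Finset.single_le_sum (f := fun j => |lam j|) (fun j _ => abs_nonneg _) (Finset.mem_univ j)
  refine ⟨8 * N ^ 3 * C, by positivity, fun ε hε => ?_⟩
  refine ⟨8 * N * C + 8 * N ^ 3 * (C * (L + C)) / ε, by positivity, fun a ha aV haV hA => ?_⟩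
  have ha1 : 8 * N * C ≤ |a| := le_trans (le_add_of_nonneg_right (by positivity)) ha
  have ha2 : 8 * N ^ 3 * (C * (L + C)) / ε ≤ |a| :=
    le_trans (le_add_of_nonneg_left (by positivity)) ha
  have ha0 : 0 < |a| := lt_of_lt_of_le (by positivity) ha1
  have hane : a ≠ 0 := abs_pos.mp ha0
  have hbound : C * (L + C) / |a| ≤ ε / (8 * N ^ 3) := by
    rw [div_le_iff₀ hε] at ha2
    rw [div_le_div_iff₀ ha0 (by positivity)]
    linarith
  have hres : ∀ j x, |x| ≤ L + C → |aV j * x / a| ≤ ε / (8 * N ^ 3) := by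
    intro j x hx
    refine le_trans ?_ hbound
    rw [abs_div, abs_mul]
    gcongr
    exact haV j
  obtain ⟨e, he⟩ := hA.exists_perm_abs_eigenvalues_sub_le
    (Matrix.fromBlocks 1 0 (Matrix.of fun j _ => -(aV j / a)) 1)
    (Sum.elim (fun _ => a) lam) (Sum.elim (fun _ => 8 * N ^ 3 * C) fun _ => ε)
    (by rintro (i | i) <;> simp only [Sum.elim_inl, Sum.elim_inr] <;> positivity)
    (by
      rw [← hN, ← Matrix.fromBlocks_one]
      rintro (i | i) (j | j)
      · simp [hN0.le]
      · simp [hN0.le]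
      · simp only [Matrix.fromBlocks_apply₂₁, Matrix.of_apply, Matrix.zero_apply, sub_zero,
          abs_neg, abs_div]
        rw [div_le_div_iff₀ ha0 (by positivity)]
        nlinarith [haV i]
      · simp [hN0.le])
    (by
      rw [← hN, arrowMat, Matrix.fromBlocks_multiply]
      have hC' : 8 * N ^ 3 * C / (8 * N ^ 3) = C := by field_simp
      rintro (i | i) (j | j)
      · simp [hC', hC.le]
      · simpa [hC'] using haV j
      · have h := hres i (lam i) (by linarith [hlam i])
        have h_eq : -(aV i / a * a) + aV i + lam i * (aV i / a) = aV i * lam i / a := by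
          field_simp
          ring
        simpa [Matrix.mul_apply, h_eq] using h
      · have h := hres i (aV j) (by linarith [haV j])
        rw [← abs_neg] at h
        have h_eq : -(aV i / a * aV j) + Matrix.diagonal lam i j
            - lam i * (1 : Matrix (Fin n) (Fin n) ℝ) i j = -(aV i * aV j / a) := by
          rcases eq_or_ne i j with rfl | hij
          · simp
            ring
          · simp [hij]
            ring
        simpa [Matrix.mul_apply, h_eq] using h)
  exact ⟨e, fun j => he (Sum.inr j), he (Sum.inl ())⟩
end

section
/- Fix λ′_1, …, λ′_n ∈ ℝ and C > 0. There exists a constant C₂ > 0, depending only on λ′_1, …, λ′_n and C (and not on τ), such that for every ε > 0 there exists R > 0 with the following property: for every parameter τ ∈ (0,1], every a ∈ ℝ with |a| ≥ R, and every a_1, …, a_n ∈ ℝ with |a_j| ≤ C, the (n+1)×(n+1) symmetric matrix A with A_{00} = a/τ, A_{0j} = A_{j0} = a_j/√τ, A_{jj} = λ′_j and all other entries zero has its eigenvalues (with multiplicity) enumerable as μ_1, …, μ_n, μ_{n+1} with |μ_j − λ′_j| ≤ ε for 1 ≤ j ≤ n and |τ·μ_{n+1} − a| ≤ C₂. -/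
/-- If `w i` are approximate eigenvectors of a symmetric operator `T`, with approximate eigenvalues
`d i` and residuals at most `η`, and the synthesis map of `w` does not shrink norms, then the
eigenvalues of `T` can be matched bijectively with the `d i` up to an error `ε > card ι * η`. -/
theorem exists_perm_abs_eigenvalue_sub_le {ι E : Type*} [Fintype ι] [NormedAddCommGroup E]
    [InnerProductSpace ℝ E] {T : E →ₗ[ℝ] E} (hT : T.IsSymmetric) (u : OrthonormalBasis ι ℝ E)
    (μ d : ι → ℝ) (hu : ∀ k, T (u k) = μ k • u k) (w : ι → E) {η ε : ℝ}
    (hres : ∀ i, ‖T (w i) - d i • w i‖ ≤ η)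
    (hw : ∀ c : ι → ℝ, ∑ i, c i ^ 2 ≤ ‖∑ i, c i • w i‖ ^ 2)
    (hε : 0 < ε) (hη : Fintype.card ι * η < ε) :
    ∃ e : Equiv.Perm ι, ∀ i, |μ (e i) - d i| ≤ ε := by
  classical
  have hcoef : ∀ i k, ε < |μ k - d i| → |inner ℝ (u k) (w i)| ≤ η / ε := by
    intro i k hik
    have h1 : inner ℝ (u k) (T (w i) - d i • w i) = (μ k - d i) * inner ℝ (u k) (w i) := by
      rw [inner_sub_right, ← hT, hu, real_inner_smul_left, real_inner_smul_right]
      ring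
    have h2 : |inner ℝ (u k) (T (w i) - d i • w i)| ≤ η := by
      refine (abs_real_inner_le_norm _ _).trans ?_
      rw [u.norm_eq_one, one_mul]
      exact hres i
    rw [h1, abs_mul] at h2
    rw [le_div_iff₀ hε]
    nlinarith [abs_nonneg (inner ℝ (u k) (w i))]
  let t : ι → Finset ι := fun i => {k | |μ k - d i| ≤ ε}
  have hall : ∀ s : Finset ι, s.card ≤ (s.biUnion t).card := by
    intro s
    by_contra! hlt
    let L : (s → ℝ) →ₗ[ℝ] (↥(s.biUnion t) → ℝ) :=
      Matrix.mulVecLin (Matrix.of fun k i => inner ℝ (u k) (w i))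
    have hker : LinearMap.ker L ≠ ⊥ := LinearMap.ker_ne_bot_of_finrank_lt (by
      simpa only [Module.finrank_fintype_fun_eq_card, Fintype.card_coe] using hlt)
    obtain ⟨c₀, hc₀, hne⟩ := (Submodule.ne_bot_iff _).1 hker
    let c : ι → ℝ := fun i => if h : i ∈ s then c₀ ⟨i, h⟩ else 0
    have hcs : ∀ i : s, c i = c₀ i := fun i => by simp [c]
    have hc_out : ∀ i, i ∉ s → c i = 0 := fun i hi => by simp [c, hi]
    set v := ∑ i, c i • w i with hv
    have hinner : ∀ k, inner ℝ (u k) v = ∑ i, c i * inner ℝ (u k) (w i) := by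
      intro k
      simp [hv, inner_sum, real_inner_smul_right]
    have hzero : ∀ k ∈ s.biUnion t, inner ℝ (u k) v = 0 := by
      intro k hk
      have h := congrFun (LinearMap.mem_ker.1 hc₀) ⟨k, hk⟩
      simp only [L, Matrix.mulVecLin_apply, Matrix.mulVec, dotProduct, Matrix.of_apply,
        Pi.zero_apply] at h
      rw [hinner, ← Finset.sum_subset (Finset.subset_univ s)
        (fun i _ hi => by rw [hc_out i hi, zero_mul]), ← Finset.sum_coe_sort s, ← h]
      exact Finset.sum_congr rfl fun i _ => by rw [hcs, mul_comm]
    have hcpos : 0 < ∑ i, c i ^ 2 := by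
      obtain ⟨i, hi⟩ := Function.ne_iff.1 hne
      refine Finset.sum_pos' (fun _ _ => sq_nonneg _) ⟨i, Finset.mem_univ _, ?_⟩
      rw [hcs]
      exact sq_pos_of_ne_zero hi
    have hbound : ∀ k, inner ℝ (u k) v ^ 2 ≤
        (∑ i, c i ^ 2) * (Fintype.card ι * (η / ε) ^ 2) := by
      intro k
      by_cases hk : k ∈ s.biUnion t
      · rw [hzero k hk, zero_pow two_ne_zero]
        positivity
      · have hterm : ∀ i, c i * inner ℝ (u k) (w i) =
            c i * (if i ∈ s then inner ℝ (u k) (w i) else 0) := by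
          intro i
          by_cases hi : i ∈ s
          · simp [hi]
          · simp [hi, hc_out i hi]
        rw [hinner, Finset.sum_congr rfl fun i _ => hterm i]
        refine (Finset.sum_mul_sq_le_sq_mul_sq _ _ _).trans ?_
        refine mul_le_mul_of_nonneg_left ?_ hcpos.le
        refine (Finset.sum_le_card_nsmul _ _ ((η / ε) ^ 2) fun i _ => ?_).trans ?_
        · by_cases hi : i ∈ s
          · rw [if_pos hi]
            refine sq_le_sq.2 ((hcoef i k ?_).trans (le_abs_self _))
            by_contra! hle
            exact hk (Finset.mem_biUnion.2 ⟨i, hi, by simpa [t] using hle⟩)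
          · rw [if_neg hi, zero_pow two_ne_zero]
            positivity
        · simp
    have hnorm : ‖v‖ ^ 2 ≤ (∑ i, c i ^ 2) * (Fintype.card ι * (η / ε)) ^ 2 := by
      rw [← u.sum_sq_inner_right]
      refine (Finset.sum_le_card_nsmul _ _ _ fun k _ => hbound k).trans (le_of_eq ?_)
      rw [Finset.card_univ, nsmul_eq_mul]
      ring
    obtain ⟨i₀, -⟩ := Function.ne_iff.1 hne
    have hη0 : 0 ≤ η := (norm_nonneg _).trans (hres i₀)
    have hsmall : (Fintype.card ι * (η / ε)) ^ 2 < 1 := by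
      have h1 : Fintype.card ι * (η / ε) < 1 := by rwa [← mul_div_assoc, div_lt_one hε]
      exact pow_lt_one₀ (by positivity) h1 two_ne_zero
    nlinarith [hw c]
  obtain ⟨f, hf, hft⟩ := (Finset.all_card_le_biUnion_card_iff_exists_injective t).1 hall
  exact ⟨Equiv.ofBijective f (Finite.injective_iff_bijective.1 hf),
    fun i => by simpa [t] using hft i⟩

theorem EuclideanSpace.norm_le_sum_abs {ι : Type*} [Fintype ι] (x : EuclideanSpace ℝ ι) :
    ‖x‖ ≤ ∑ i, |x i| := by
  rw [EuclideanSpace.norm_eq]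
  refine Real.sqrt_le_iff.2 ⟨Finset.sum_nonneg fun _ _ => abs_nonneg _, ?_⟩
  simpa using Finset.sum_sq_le_sq_sum_of_nonneg (s := Finset.univ) (f := fun i => |x i|)
    fun _ _ => abs_nonneg _

/-- First-order approximations to the eigenvectors of an arrow matrix, with `b` the ratio of the
border to the corner entry. -/
def arrowApproxEigenvector {n : ℕ} (b : Fin n → ℝ) :
    Unit ⊕ Fin n → EuclideanSpace ℝ (Unit ⊕ Fin n) :=
  Sum.elim (fun _ => WithLp.toLp 2 (Sum.elim (fun _ => 1) b))
    (fun j => WithLp.toLp 2 (Sum.elim (fun _ => -b j) (Pi.single j 1)))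

theorem sum_sq_le_norm_sq_sum_arrowApproxEigenvector {n : ℕ} (b : Fin n → ℝ)
    (c : Unit ⊕ Fin n → ℝ) :
    ∑ i, c i ^ 2 ≤ ‖∑ i, c i • arrowApproxEigenvector b i‖ ^ 2 := by
  rw [EuclideanSpace.real_norm_sq_eq]
  have hl : (∑ i, c i • arrowApproxEigenvector b i) (Sum.inl ()) =
      c (Sum.inl ()) - ∑ j, b j * c (Sum.inr j) := by
    simp [arrowApproxEigenvector, sub_eq_add_neg, mul_comm]
  have hr : ∀ j, (∑ i, c i • arrowApproxEigenvector b i) (Sum.inr j) =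
      b j * c (Sum.inl ()) + c (Sum.inr j) := by
    intro j
    simp [arrowApproxEigenvector, Pi.single_apply, mul_comm]
  have hexp : ∑ j, (b j * c (Sum.inl ()) + c (Sum.inr j)) ^ 2 =
      ∑ j, (b j * c (Sum.inl ())) ^ 2 + 2 * c (Sum.inl ()) * ∑ j, b j * c (Sum.inr j) +
        ∑ j, c (Sum.inr j) ^ 2 := by
    rw [Finset.mul_sum, ← Finset.sum_add_distrib, ← Finset.sum_add_distrib]
    exact Finset.sum_congr rfl fun j _ => by ring
  have hnn : 0 ≤ ∑ j, (b j * c (Sum.inl ())) ^ 2 := Finset.sum_nonneg fun _ _ => sq_nonneg _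
  rw [Fintype.sum_sum_type, Fintype.sum_sum_type]
  simp only [Finset.univ_unique, PUnit.default_eq_unit, Finset.sum_singleton, hl, hr, hexp]
  nlinarith [sq_nonneg (∑ j, b j * c (Sum.inr j))]

theorem norm_arrowMat_residual_le {n : ℕ} (lam aV : Fin n → ℝ) {C τ a : ℝ}
    (hτ : τ ∈ Set.Ioc (0 : ℝ) 1) (ha : a ≠ 0) (haV : ∀ j, |aV j| ≤ C) (i : Unit ⊕ Fin n) :
    ‖Matrix.toEuclideanLin (arrowMat (a / τ) (fun j => aV j / Real.sqrt τ) lam)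
        (arrowApproxEigenvector (fun j => Real.sqrt τ * aV j / a) i) -
      Sum.elim (fun _ => a / τ) lam i •
        arrowApproxEigenvector (fun j => Real.sqrt τ * aV j / a) i‖ ≤
      (n * C ^ 2 + (∑ j, |lam j|) * C) / |a| := by
  have hs : 0 < Real.sqrt τ := Real.sqrt_pos.2 hτ.1
  have hs1 : Real.sqrt τ ≤ 1 := Real.sqrt_le_one.2 hτ.2
  have hss : Real.sqrt τ * Real.sqrt τ = τ := Real.mul_self_sqrt hτ.1.le
  have hτ0 : τ ≠ 0 := hτ.1.ne'
  have ha' : 0 < |a| := abs_pos.2 ha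
  have hmul : ∀ j k, |aV j * aV k / a| ≤ C ^ 2 / |a| := by
    intro j k
    rw [abs_div, abs_mul, sq]
    have := haV j
    have := haV k
    have := (abs_nonneg _).trans (haV j)
    gcongr
  have hlam : ∀ j, |lam j * (Real.sqrt τ * aV j / a)| ≤ |lam j| * C / |a| := by
    intro j
    have h1 : |Real.sqrt τ * aV j| ≤ C := by
      rw [abs_mul, abs_of_pos hs]
      nlinarith [haV j, abs_nonneg (aV j)]
    rw [abs_mul, abs_div, mul_div_assoc]
    gcongr
  refine (EuclideanSpace.norm_le_sum_abs _).trans ?_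
  rw [add_div, Finset.sum_mul, Finset.sum_div, Fintype.sum_sum_type]
  rcases i with _ | j
  · have hl : (Matrix.toEuclideanLin (arrowMat (a / τ) (fun j => aV j / Real.sqrt τ) lam)
        (arrowApproxEigenvector (fun j => Real.sqrt τ * aV j / a) (Sum.inl ())) -
      (a / τ) • arrowApproxEigenvector (fun j => Real.sqrt τ * aV j / a) (Sum.inl ())) (Sum.inl ())
        = ∑ j, aV j * aV j / a := by
      simp [arrowApproxEigenvector, arrowMat, Matrix.toLpLin_apply, Matrix.mulVec, dotProduct]
      refine Finset.sum_congr rfl fun j _ => ?_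
      field_simp
    have hr : ∀ k, (Matrix.toEuclideanLin (arrowMat (a / τ) (fun j => aV j / Real.sqrt τ) lam)
        (arrowApproxEigenvector (fun j => Real.sqrt τ * aV j / a) (Sum.inl ())) -
      (a / τ) • arrowApproxEigenvector (fun j => Real.sqrt τ * aV j / a) (Sum.inl ())) (Sum.inr k)
        = lam k * (Real.sqrt τ * aV k / a) := by
      intro k
      simp [arrowApproxEigenvector, arrowMat, Matrix.toLpLin_apply, Matrix.mulVec, dotProduct,
        Matrix.diagonal_apply]
      have : aV k / Real.sqrt τ = a / τ * (Real.sqrt τ * aV k / a) := by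
        field_simp
        rw [sq, hss]
      rw [this]
      ring
    simp only [Sum.elim_inl, Finset.univ_unique, PUnit.default_eq_unit, Finset.sum_singleton, hl,
      hr]
    refine add_le_add ((Finset.abs_sum_le_sum_abs _ _).trans ?_) (Finset.sum_le_sum fun k _ => hlam k)
    refine (Finset.sum_le_card_nsmul _ _ _ fun k _ => hmul k k).trans (le_of_eq ?_)
    rw [Finset.card_univ, Fintype.card_fin, nsmul_eq_mul, mul_div_assoc]
  · have hl : (Matrix.toEuclideanLin (arrowMat (a / τ) (fun j => aV j / Real.sqrt τ) lam)
        (arrowApproxEigenvector (fun j => Real.sqrt τ * aV j / a) (Sum.inr j)) -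
      lam j • arrowApproxEigenvector (fun j => Real.sqrt τ * aV j / a) (Sum.inr j)) (Sum.inl ())
        = lam j * (Real.sqrt τ * aV j / a) := by
      simp [arrowApproxEigenvector, arrowMat, Matrix.toLpLin_apply, Matrix.mulVec, dotProduct,
        Pi.single_apply]
      have : aV j / Real.sqrt τ = a / τ * (Real.sqrt τ * aV j / a) := by
        field_simp
        rw [sq, hss]
      rw [this]
      ring
    have hr : ∀ k, (Matrix.toEuclideanLin (arrowMat (a / τ) (fun j => aV j / Real.sqrt τ) lam)
        (arrowApproxEigenvector (fun j => Real.sqrt τ * aV j / a) (Sum.inr j)) -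
      lam j • arrowApproxEigenvector (fun j => Real.sqrt τ * aV j / a) (Sum.inr j)) (Sum.inr k)
        = -(aV k * aV j / a) := by
      intro k
      have : aV k / Real.sqrt τ * (Real.sqrt τ * aV j / a) = aV k * aV j / a := by
        field_simp
      by_cases hkj : k = j
      · subst hkj
        simp [arrowApproxEigenvector, arrowMat, Matrix.toLpLin_apply, Matrix.mulVec, dotProduct,
          this, Matrix.diagonal_apply]
      · simp [arrowApproxEigenvector, arrowMat, Matrix.toLpLin_apply, Matrix.mulVec, dotProduct,
          this, hkj, Matrix.diagonal_apply, Pi.single_apply]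
    simp only [Sum.elim_inr, Finset.univ_unique, PUnit.default_eq_unit, Finset.sum_singleton, hl,
      hr, abs_neg]
    rw [add_comm]
    refine add_le_add ?_ ((hlam j).trans ?_)
    · refine (Finset.sum_le_card_nsmul _ _ _ fun k _ => hmul k j).trans (le_of_eq ?_)
      rw [Finset.card_univ, Fintype.card_fin, nsmul_eq_mul, mul_div_assoc]
    · have hC : 0 ≤ C := (abs_nonneg _).trans (haV j)
      exact Finset.single_le_sum (f := fun j => |lam j| * C / |a|)
        (fun _ _ => by positivity) (Finset.mem_univ j)

/-- (CNS eigenvalue asymptotics with parameter, part 2.) Fix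
`λ'_1, …, λ'_n ∈ ℝ` and `C > 0`. There is `C₂ > 0` (depending only on the `λ'_j` and
`C`, not on `τ`) such that for every `ε > 0` there is `R > 0` so that: for every
`τ ∈ (0, 1]`, every `a` with `|a| ≥ R`, and every `a_1, …, a_n` with `|a_j| ≤ C`, the
eigenvalues of the symmetric arrow matrix with corner `a/τ`, border entries `a_j/√τ`
and diagonal `(λ'_1, …, λ'_n)` can be enumerated as `μ_1, …, μ_n, μ_{n+1}` with
`|μ_j - λ'_j| ≤ ε` for `1 ≤ j ≤ n` and `|τ·μ_{n+1} - a| ≤ C₂`. -/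
theorem stmt9 {n : ℕ} (lam : Fin n → ℝ) (C : ℝ) (hC : 0 < C) :
    ∃ C₂ > (0 : ℝ), ∀ ε > (0 : ℝ), ∃ R > (0 : ℝ),
      ∀ τ ∈ Set.Ioc (0 : ℝ) 1, ∀ a : ℝ, R ≤ |a| →
        ∀ aV : Fin n → ℝ, (∀ j, |aV j| ≤ C) →
          ∀ hA : (arrowMat (a / τ) (fun j => aV j / Real.sqrt τ) lam).IsHermitian,
            ∃ e : Equiv.Perm (Unit ⊕ Fin n),
              (∀ j : Fin n, |hA.eigenvalues (e (Sum.inr j)) - lam j| ≤ ε) ∧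
              |τ * hA.eigenvalues (e (Sum.inl ())) - a| ≤ C₂ := by
  refine ⟨1, one_pos, fun ε hε => ?_⟩
  set K : ℝ := n * C ^ 2 + (∑ j, |lam j|) * C with hK
  have hK0 : 0 ≤ K := by positivity
  have hδ : 0 < min ε 1 := lt_min hε one_pos
  refine ⟨((n + 1) * K + 1) / min ε 1, by positivity, ?_⟩
  intro τ hτ a ha aV haV hA
  have ha' : 0 < |a| := lt_of_lt_of_le (by positivity) ha
  have hsmall : Fintype.card (Unit ⊕ Fin n) * (K / |a|) < min ε 1 := by
    rw [div_le_iff₀ hδ] at ha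
    rw [Fintype.card_sum, Fintype.card_unit, Fintype.card_fin, ← mul_div_assoc, div_lt_iff₀ ha']
    push_cast
    linarith
  obtain ⟨e, he⟩ := exists_perm_abs_eigenvalue_sub_le (Matrix.isSymmetric_toEuclideanLin_iff.2 hA)
    hA.eigenvectorBasis hA.eigenvalues (Sum.elim (fun _ => a / τ) lam)
    (fun k => by
      ext i
      simpa [Matrix.toLpLin_apply] using congrFun (hA.mulVec_eigenvectorBasis k) i)
    _ (norm_arrowMat_residual_le lam aV hτ (abs_pos.1 ha') haV)
    (sum_sq_le_norm_sq_sum_arrowApproxEigenvector _) hδ hsmall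
  refine ⟨e, fun j => (he (Sum.inr j)).trans (min_le_left _ _), ?_⟩
  have h := (he (Sum.inl ())).trans (min_le_right _ _)
  rw [Sum.elim_inl] at h
  have hmul : τ * hA.eigenvalues (e (Sum.inl ())) - a =
      τ * (hA.eigenvalues (e (Sum.inl ())) - a / τ) := by
    rw [mul_sub, mul_div_cancel₀ _ hτ.1.ne']
  rw [hmul, abs_mul, abs_of_pos hτ.1]
  exact mul_le_one₀ hτ.2 (abs_nonneg _) h
end

section
/- Let n ≥ 1 and let u₀, u₁ : ℝⁿ → ℝ be smooth functions such that ∇u₀, ∇u₁, and u₁ − u₀ are ℤⁿ-periodic. Let Θ ∈ [(n−1)π/2, (n+1)π/2) be a constant and assume ϑ(∇²u_i(x)) > Θ − π/2 for all x ∈ ℝⁿ and i = 0, 1. Then for every τ ∈ (0,1] there exists a smooth function v^τ : [0,√τ] × ℝⁿ → ℝ, ℤⁿ-periodic in the ℝⁿ variable, with v^τ(0,·) ≡ 0 and v^τ(√τ,·) ≡ 0, such that for all (s,x) ∈ [0,√τ] × ℝⁿ the full (n+1)×(n+1) Hessian in the variables (s,x) of the function w^τ := ũ^τ + v^τ satisfies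 ∑_{j=1}^{n+1} arctan λ_j(D²w^τ(s,x)) = Θ, where ũ^τ(s,x) = (1 − s/√τ)·u₀(x) + (s/√τ)·u₁(x). -/
/-- The Lagrangian phase `ϑ(M) = ∑ arctan λ_j(M)` of a real symmetric matrix, where the
`λ_j(M)` are its eigenvalues listed with multiplicity; `0` if `M` is not symmetric. -/
noncomputable def lagPhase {ι : Type*} [Fintype ι] [DecidableEq ι]
    (M : Matrix ι ι ℝ) : ℝ :=
  if h : M.IsHermitian then ∑ j, Real.arctan (h.eigenvalues j) else 0

/-- The Hessian matrix of a function `f : ℝ^m → ℝ` at a point `x`. -/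
noncomputable def hess {m : ℕ} (f : (Fin m → ℝ) → ℝ) (x : Fin m → ℝ) :
    Matrix (Fin m) (Fin m) ℝ :=
  Matrix.of fun i j => fderiv ℝ (fun y => fderiv ℝ f y (Pi.single j 1)) x (Pi.single i 1)

theorem arctan_add_arctan_eq_of_tan {l m Θ : ℝ} (h0 : 0 ≤ Θ) (h1 : Θ < Real.pi / 2)
    (htr : l + m = Real.tan Θ * (1 - l * m)) (hr : 0 < (1 - l * m) + Real.tan Θ * (l + m)) :
    Real.arctan l + Real.arctan m = Θ := by
  have hcΘ : 0 < Real.cos Θ := Real.cos_pos_of_mem_Ioo ⟨by linarith [Real.pi_pos], h1⟩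
  have hsΘ : Real.sin Θ = Real.tan Θ * Real.cos Θ := (Real.tan_mul_cos hcΘ.ne').symm
  have hcl := Real.cos_arctan_pos l
  have hcm := Real.cos_arctan_pos m
  have hsl : Real.sin (Real.arctan l) = l * Real.cos (Real.arctan l) := by
    conv_rhs => rw [← Real.tan_arctan l, Real.arctan_tan (Real.neg_pi_div_two_lt_arctan l)
      (Real.arctan_lt_pi_div_two l)]
    exact (Real.tan_mul_cos hcl.ne').symm
  have hsm : Real.sin (Real.arctan m) = m * Real.cos (Real.arctan m) := by
    conv_rhs => rw [← Real.tan_arctan m, Real.arctan_tan (Real.neg_pi_div_two_lt_arctan m)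
      (Real.arctan_lt_pi_div_two m)]
    exact (Real.tan_mul_cos hcm.ne').symm
  have hsin : Real.sin (Real.arctan l + Real.arctan m - Θ) = 0 := by
    rw [Real.sin_sub, Real.sin_add, Real.cos_add, hsl, hsm, hsΘ]
    linear_combination Real.cos (Real.arctan l) * Real.cos (Real.arctan m) * Real.cos Θ * htr
  have hcos : 0 < Real.cos (Real.arctan l + Real.arctan m - Θ) := by
    have : Real.cos (Real.arctan l + Real.arctan m - Θ) = Real.cos (Real.arctan l) *
        Real.cos (Real.arctan m) * Real.cos Θ * ((1 - l * m) + Real.tan Θ * (l + m)) := by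
      rw [Real.cos_sub, Real.sin_add, Real.cos_add, hsl, hsm, hsΘ]
      ring
    rw [this]
    positivity
  have hb1 := Real.neg_pi_div_two_lt_arctan l
  have hb2 := Real.neg_pi_div_two_lt_arctan m
  have hb3 := Real.arctan_lt_pi_div_two l
  have hb4 := Real.arctan_lt_pi_div_two m
  have key : Real.arctan l + Real.arctan m - Θ = 0 := by
    rcases lt_or_ge (-Real.pi) (Real.arctan l + Real.arctan m - Θ) with h | h
    · exact (Real.sin_eq_zero_iff_of_lt_of_lt h (by linarith)).1 hsin
    · exfalso
      have := Real.cos_nonpos_of_pi_div_two_le_of_le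
        (x := -(Real.arctan l + Real.arctan m - Θ)) (by linarith) (by linarith)
      rw [Real.cos_neg] at this
      linarith
  linarith

theorem lagPhase_fin_two_eq {M : Matrix (Fin 2) (Fin 2) ℝ} (hM : M.IsHermitian) {Θ : ℝ}
    (h0 : 0 ≤ Θ) (h1 : Θ < Real.pi / 2) (hpos : 0 < 1 + Real.tan Θ * M 1 1)
    (heq : M 0 0 * (1 + Real.tan Θ * M 1 1) = Real.tan Θ * (1 + M 0 1 ^ 2) - M 1 1) :
    lagPhase M = Θ := by
  have htr := hM.trace_eq_sum_eigenvalues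
  have hdet := hM.det_eq_prod_eigenvalues
  have hsym : M 1 0 = M 0 1 := by simpa using hM.apply 0 1
  simp only [Matrix.trace_fin_two, Matrix.det_fin_two, Fin.sum_univ_two, Fin.prod_univ_two,
    RCLike.ofReal_real_eq_id, id_eq, hsym] at htr hdet
  rw [lagPhase, dif_pos hM, Fin.sum_univ_two]
  refine arctan_add_arctan_eq_of_tan h0 h1 ?_ ?_
  · rw [← htr, ← hdet]; linear_combination heq
  · rw [← htr, ← hdet]
    refine pos_of_mul_pos_left (b := 1 + Real.tan Θ * M 1 1) ?_ hpos.le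
    have : (1 - (M 0 0 * M 1 1 - M 0 1 * M 0 1) + Real.tan Θ * (M 0 0 + M 1 1)) *
        (1 + Real.tan Θ * M 1 1) = (1 + Real.tan Θ ^ 2) * (1 + M 0 1 ^ 2 + M 1 1 ^ 2) := by
      linear_combination (Real.tan Θ - M 1 1) * heq
    rw [this]
    positivity

theorem lagPhase_fin_one {M : Matrix (Fin 1) (Fin 1) ℝ} : lagPhase M = Real.arctan (M 0 0) := by
  have hM : M.IsHermitian := by
    ext i j
    fin_cases i; fin_cases j; simp
  have htr := hM.trace_eq_sum_eigenvalues
  simp only [Matrix.trace_fin_one, Fin.sum_univ_one, RCLike.ofReal_real_eq_id, id_eq] at htr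
  rw [lagPhase, dif_pos hM, Fin.sum_univ_one, htr]

/-- The partial derivative in the first variable of a function on the plane. -/
noncomputable def partialFst (f : ℝ × ℝ → ℝ) (p : ℝ × ℝ) : ℝ := fderiv ℝ f p (1, 0)

/-- The partial derivative in the second variable of a function on the plane. -/
noncomputable def partialSnd (f : ℝ × ℝ → ℝ) (p : ℝ × ℝ) : ℝ := fderiv ℝ f p (0, 1)

theorem ContDiff.partialFst {f : ℝ × ℝ → ℝ} (hf : ContDiff ℝ (⊤ : ℕ∞) f) :
    ContDiff ℝ (⊤ : ℕ∞) (partialFst f) :=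
  (hf.fderiv_right (m := (⊤ : ℕ∞)) (by simp)).clm_apply contDiff_const

theorem ContDiff.partialSnd {f : ℝ × ℝ → ℝ} (hf : ContDiff ℝ (⊤ : ℕ∞) f) :
    ContDiff ℝ (⊤ : ℕ∞) (partialSnd f) :=
  (hf.fderiv_right (m := (⊤ : ℕ∞)) (by simp)).clm_apply contDiff_const

theorem hasDerivAt_slice_fst {f : ℝ × ℝ → ℝ} {s y : ℝ} (hf : DifferentiableAt ℝ f (s, y)) :
    HasDerivAt (fun r => f (r, y)) (partialFst f (s, y)) s :=
  hf.hasFDerivAt.comp_hasDerivAt s ((hasDerivAt_id s).prodMk (hasDerivAt_const s y))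

theorem hasDerivAt_slice_snd {f : ℝ × ℝ → ℝ} {s y : ℝ} (hf : DifferentiableAt ℝ f (s, y)) :
    HasDerivAt (fun r => f (s, r)) (partialSnd f (s, y)) y :=
  hf.hasFDerivAt.comp_hasDerivAt y ((hasDerivAt_const y s).prodMk (hasDerivAt_id y))

theorem partialFst_eq {f : ℝ × ℝ → ℝ} {s y d : ℝ} (hf : DifferentiableAt ℝ f (s, y))
    (h : HasDerivAt (fun r => f (r, y)) d s) : partialFst f (s, y) = d :=
  (hasDerivAt_slice_fst hf).unique h

theorem partialSnd_eq {f : ℝ × ℝ → ℝ} {s y d : ℝ} (hf : DifferentiableAt ℝ f (s, y))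
    (h : HasDerivAt (fun r => f (s, r)) d y) : partialSnd f (s, y) = d :=
  (hasDerivAt_slice_snd hf).unique h

theorem partialFst_partialSnd {f : ℝ × ℝ → ℝ} (hf : ContDiff ℝ (⊤ : ℕ∞) f) :
    partialFst (partialSnd f) = partialSnd (partialFst f) := by
  ext p
  have hd : DifferentiableAt ℝ (fderiv ℝ f) p :=
    ((hf.fderiv_right (m := (⊤ : ℕ∞)) (by simp)).differentiable (by simp)) p
  have hsym : IsSymmSndFDerivAt ℝ f p := (hf.contDiffAt (x := p)).isSymmSndFDerivAt (by
    simp only [minSmoothness_of_isRCLikeNormedField]; exact WithTop.coe_le_coe.2 le_top)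
  change fderiv ℝ (fun q => fderiv ℝ f q (0, 1)) p (1, 0) =
    fderiv ℝ (fun q => fderiv ℝ f q (1, 0)) p (0, 1)
  rw [fderiv_clm_apply hd (by fun_prop), fderiv_clm_apply hd (by fun_prop)]
  simpa using hsym.eq (1, 0) (0, 1)

theorem partialSnd_add_one {f : ℝ × ℝ → ℝ} (hf : ContDiff ℝ (⊤ : ℕ∞) f)
    (hper : ∀ s y, f (s, y + 1) = f (s, y)) (s y : ℝ) :
    partialSnd f (s, y + 1) = partialSnd f (s, y) := by
  refine (partialSnd_eq (hf.differentiable (by simp) _) ?_).symm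
  have h1 := (hasDerivAt_slice_snd (hf.differentiable (by simp) (s, y + 1))).comp_add_const y 1
  simpa only [hper] using h1

/-- A smooth function all of whose derivatives are bounded. -/
def BoundedDerivs {E F : Type*} [NormedAddCommGroup E] [NormedSpace ℝ E] [NormedAddCommGroup F]
    [NormedSpace ℝ F] (f : E → F) : Prop :=
  ContDiff ℝ (⊤ : ℕ∞) f ∧ ∀ m : ℕ, ∃ C : ℝ, ∀ x, ‖iteratedFDeriv ℝ m f x‖ ≤ C

theorem BoundedDerivs.norm_le {E F : Type*} [NormedAddCommGroup E] [NormedSpace ℝ E]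
    [NormedAddCommGroup F] [NormedSpace ℝ F] {f : E → F} (hf : BoundedDerivs f) :
    ∃ C : ℝ, 0 ≤ C ∧ ∀ x, ‖f x‖ ≤ C := by
  obtain ⟨C, hC⟩ := hf.2 0
  refine ⟨C, (norm_nonneg _).trans (hC 0), fun x => ?_⟩
  simpa using hC x

theorem norm_iteratedFDeriv_comp_clm_le {D E F : Type*} [NormedAddCommGroup D] [NormedSpace ℝ D]
    [NormedAddCommGroup E] [NormedSpace ℝ E] [NormedAddCommGroup F] [NormedSpace ℝ F]
    {f : E → F} (hf : ContDiff ℝ (⊤ : ℕ∞) f) (L : D →L[ℝ] E) (m : ℕ) (x : D) :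
    ‖iteratedFDeriv ℝ m (f ∘ L) x‖ ≤ ‖iteratedFDeriv ℝ m f (L x)‖ * ‖L‖ ^ m := by
  rw [L.iteratedFDeriv_comp_right hf x (by exact_mod_cast le_top)]
  refine (ContinuousMultilinearMap.norm_compContinuousLinearMap_le _ _).trans ?_
  simp

theorem BoundedDerivs.comp_clm {D E F : Type*} [NormedAddCommGroup D] [NormedSpace ℝ D]
    [NormedAddCommGroup E] [NormedSpace ℝ E] [NormedAddCommGroup F] [NormedSpace ℝ F]
    {f : E → F} (hf : BoundedDerivs f) (L : D →L[ℝ] E) : BoundedDerivs (f ∘ L) := by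
  refine ⟨hf.1.comp L.contDiff, fun m => ?_⟩
  obtain ⟨C, hC⟩ := hf.2 m
  exact ⟨C * ‖L‖ ^ m, fun x => (norm_iteratedFDeriv_comp_clm_le hf.1 L m x).trans
    (mul_le_mul_of_nonneg_right (hC _) (by positivity))⟩

theorem BoundedDerivs.clm_comp {E F G : Type*} [NormedAddCommGroup E] [NormedSpace ℝ E]
    [NormedAddCommGroup F] [NormedSpace ℝ F] [NormedAddCommGroup G] [NormedSpace ℝ G]
    {f : E → F} (hf : BoundedDerivs f) (L : F →L[ℝ] G) : BoundedDerivs (L ∘ f) := by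
  refine ⟨L.contDiff.comp hf.1, fun m => ?_⟩
  obtain ⟨C, hC⟩ := hf.2 m
  refine ⟨‖L‖ * C, fun x => ?_⟩
  rw [L.iteratedFDeriv_comp_left hf.1.contDiffAt (by exact_mod_cast le_top)]
  exact (L.norm_compContinuousMultilinearMap_le _).trans
    (mul_le_mul_of_nonneg_left (hC x) (norm_nonneg _))

theorem BoundedDerivs.mul {E : Type*} [NormedAddCommGroup E] [NormedSpace ℝ E] {f g : E → ℂ}
    (hf : BoundedDerivs f) (hg : BoundedDerivs g) : BoundedDerivs fun x => f x * g x := by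
  refine ⟨hf.1.mul hg.1, fun m => ?_⟩
  choose A hA using hf.2
  choose B hB using hg.2
  refine ⟨∑ i ∈ Finset.range (m + 1), (m.choose i : ℝ) * A i * B (m - i), fun x => ?_⟩
  refine (norm_iteratedFDeriv_mul_le hf.1 hg.1 x (by exact_mod_cast le_top)).trans
    (Finset.sum_le_sum fun i _ => ?_)
  have h0 : 0 ≤ A i := (norm_nonneg _).trans (hA i x)
  have := hA i x
  have := hB (m - i) x
  gcongr

theorem BoundedDerivs.deriv {f : ℝ → ℝ} (hf : BoundedDerivs f) : BoundedDerivs (deriv f) := by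
  refine ⟨(contDiff_infty_iff_deriv.1 hf.1).2, fun m => ?_⟩
  obtain ⟨C, hC⟩ := hf.2 (m + 1)
  refine ⟨C, fun x => ?_⟩
  have := hC x
  rw [norm_iteratedFDeriv_eq_norm_iteratedDeriv] at this ⊢
  rwa [iteratedDeriv_succ'] at this

theorem boundedDerivs_cexp_mul_I : BoundedDerivs fun θ : ℝ => Complex.exp (θ * Complex.I) := by
  refine ⟨Complex.contDiff_exp.comp (Complex.ofRealCLM.contDiff.mul contDiff_const),
    fun m => ⟨1, fun x => ?_⟩⟩
  rw [norm_iteratedFDeriv_eq_norm_iteratedDeriv]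
  have : ∀ m : ℕ, iteratedDeriv m (fun θ : ℝ => Complex.exp (θ * Complex.I)) =
      fun θ : ℝ => Complex.I ^ m * Complex.exp (θ * Complex.I) := by
    intro m
    induction m with
    | zero => ext; simp
    | succ m ih =>
      rw [iteratedDeriv_succ, ih]
      ext θ
      have h := (((Complex.ofRealCLM.hasDerivAt (x := θ)).mul_const Complex.I).cexp).const_mul
        (Complex.I ^ m)
      simp only [Complex.ofRealCLM_apply] at h
      rw [h.deriv]
      simp; ring
  rw [this]
  simp [Complex.norm_exp_ofReal_mul_I]

/-- A smooth function with bounded derivatives that agrees with `exp (-r)` for `r ≥ -1/2`. -/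
noncomputable def decayProfile (r : ℝ) : ℝ := Real.exp (-r) * Real.smoothTransition (2 * r + 2)

theorem decayProfile_of_ge {r : ℝ} (hr : -(1 / 2) ≤ r) : decayProfile r = Real.exp (-r) := by
  rw [decayProfile, Real.smoothTransition.one_of_one_le (by linarith), mul_one]

theorem contDiff_decayProfile : ContDiff ℝ (⊤ : ℕ∞) decayProfile := by
  unfold decayProfile
  exact (Real.contDiff_exp.comp contDiff_neg).mul
    (Real.smoothTransition.contDiff.comp ((contDiff_const.mul contDiff_id).add contDiff_const))

theorem iteratedDeriv_exp_neg (m : ℕ) :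
    iteratedDeriv m (fun r : ℝ => Real.exp (-r)) = fun r => (-1) ^ m * Real.exp (-r) := by
  induction m with
  | zero => ext; simp
  | succ m ih =>
    rw [iteratedDeriv_succ, ih]
    ext r
    rw [(((hasDerivAt_neg r).exp).const_mul ((-1 : ℝ) ^ m)).deriv]
    ring

theorem iteratedDeriv_decayProfile (m : ℕ) {r : ℝ} (hr : -(1 / 2) < r) :
    iteratedDeriv m decayProfile r = (-1) ^ m * Real.exp (-r) := by
  have : decayProfile =ᶠ[nhds r] fun r => Real.exp (-r) := by
    filter_upwards [lt_mem_nhds hr] with x hx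
    exact decayProfile_of_ge hx.le
  rw [this.iteratedDeriv_eq, iteratedDeriv_exp_neg]

theorem boundedDerivs_decayProfile : BoundedDerivs decayProfile := by
  refine ⟨contDiff_decayProfile, fun m => ?_⟩
  have hc : Continuous (fun r => iteratedDeriv m decayProfile r) :=
    contDiff_decayProfile.continuous_iteratedDeriv m (by exact_mod_cast le_top)
  obtain ⟨C, hC⟩ := (isCompact_Icc (a := (-1 : ℝ)) (b := 0)).exists_bound_of_continuousOn
    hc.continuousOn
  refine ⟨max C 1, fun r => ?_⟩
  rw [norm_iteratedFDeriv_eq_norm_iteratedDeriv]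
  rcases lt_or_ge r (-1) with h | h
  · have : decayProfile =ᶠ[nhds r] fun _ => (0 : ℝ) := by
      filter_upwards [gt_mem_nhds h] with x hx
      rw [decayProfile, Real.smoothTransition.zero_of_nonpos (by linarith), mul_zero]
    rw [this.iteratedDeriv_eq]
    simp
  · rcases le_or_gt r 0 with h' | h'
    · exact (hC r ⟨h, h'⟩).trans (le_max_left _ _)
    · rw [iteratedDeriv_decayProfile m (by linarith)]
      refine le_trans ?_ (le_max_right _ _)
      simp [abs_of_pos (Real.exp_pos _), h'.le]

/-- Coefficient sequences that decay faster than any power. -/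
def RapidDecay (a : ℤ → ℂ) : Prop := ∀ m : ℕ, Summable fun k : ℤ => |(k : ℝ)| ^ m * ‖a k‖

theorem RapidDecay.of_norm_le {a b : ℤ → ℂ} (ha : RapidDecay a) {C : ℝ} {j : ℕ}
    (h : ∀ k, ‖b k‖ ≤ C * |(k : ℝ)| ^ j * ‖a k‖) : RapidDecay b := fun m => by
  refine Summable.of_nonneg_of_le (fun k => by positivity) (fun k => ?_)
    ((ha (m + j)).mul_left C)
  calc |(k : ℝ)| ^ m * ‖b k‖ ≤ |(k : ℝ)| ^ m * (C * |(k : ℝ)| ^ j * ‖a k‖) := by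
        gcongr; exact h k
    _ = _ := by ring

theorem RapidDecay.add {a b : ℤ → ℂ} (ha : RapidDecay a) (hb : RapidDecay b) :
    RapidDecay fun k => a k + b k := fun m => by
  refine Summable.of_nonneg_of_le (fun k => by positivity) (fun k => ?_) ((ha m).add (hb m))
  rw [← mul_add]
  gcongr
  exact norm_add_le _ _

/-- The modes `E(2πμ|k|s) exp(2πiky)` of the Dirichlet problem on a half-plane. -/
noncomputable def stripMode (μ : ℝ) (E : ℝ → ℝ) (k : ℤ) (p : ℝ × ℝ) : ℂ :=
  (E (2 * Real.pi * μ * |(k : ℝ)| * p.1) : ℂ) *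
    Complex.exp (((2 * Real.pi * k * p.2 : ℝ) : ℂ) * Complex.I)

/-- The superposition of the modes `stripMode μ E k` with coefficients `a k`. -/
noncomputable def stripSeries (μ : ℝ) (E : ℝ → ℝ) (a : ℤ → ℂ) (p : ℝ × ℝ) : ℂ :=
  ∑' k : ℤ, a k * stripMode μ E k p

theorem norm_stripMode_le {μ : ℝ} {E : ℝ → ℝ} {C : ℝ} (hC : ∀ x, ‖E x‖ ≤ C) (k : ℤ)
    (p : ℝ × ℝ) : ‖stripMode μ E k p‖ ≤ C := by
  rw [stripMode, norm_mul, Complex.norm_exp_ofReal_mul_I, mul_one, Complex.norm_real]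
  exact hC _

theorem RapidDecay.summable_norm {a : ℤ → ℂ} (ha : RapidDecay a) : Summable fun k => ‖a k‖ := by
  simpa using ha 0

theorem summable_stripSeries {μ : ℝ} {E : ℝ → ℝ} (hE : BoundedDerivs E) {a : ℤ → ℂ}
    (ha : RapidDecay a) (p : ℝ × ℝ) : Summable fun k => a k * stripMode μ E k p := by
  obtain ⟨C, -, hC⟩ := hE.norm_le
  refine Summable.of_norm_bounded (ha.summable_norm.mul_right C) fun k => ?_
  rw [norm_mul]
  gcongr
  exact norm_stripMode_le hC k p

theorem exists_norm_iteratedFDeriv_stripMode_le (μ : ℝ) {E : ℝ → ℝ} (hE : BoundedDerivs E) :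
    (∀ k, ContDiff ℝ (⊤ : ℕ∞) (stripMode μ E k)) ∧ ∀ m : ℕ, ∃ C : ℝ, ∀ (k : ℤ) (p : ℝ × ℝ),
      ‖iteratedFDeriv ℝ m (stripMode μ E k) p‖ ≤ C * |(k : ℝ)| ^ m := by
  set Q : ℝ × ℝ → ℂ := fun q => (E q.1 : ℂ) * Complex.exp ((q.2 : ℂ) * Complex.I) with hQ
  have hQb : BoundedDerivs Q :=
    ((hE.clm_comp Complex.ofRealCLM).comp_clm (ContinuousLinearMap.fst ℝ ℝ ℝ)).mul
      (boundedDerivs_cexp_mul_I.comp_clm (ContinuousLinearMap.snd ℝ ℝ ℝ))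
  set L : ℤ → (ℝ × ℝ →L[ℝ] ℝ × ℝ) := fun k =>
    ((2 * Real.pi * μ * |(k : ℝ)|) • ContinuousLinearMap.fst ℝ ℝ ℝ).prod
      ((2 * Real.pi * k) • ContinuousLinearMap.snd ℝ ℝ ℝ) with hL
  have hcomp : ∀ k, stripMode μ E k = Q ∘ L k := fun k => by
    ext p
    simp [stripMode, hQ, hL]
  have hLn : ∀ k, ‖L k‖ ≤ 2 * Real.pi * max |μ| 1 * |(k : ℝ)| := fun k => by
    refine ContinuousLinearMap.opNorm_le_bound _ (by positivity) fun p => ?_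
    have h1 : ‖p.1‖ ≤ ‖p‖ := norm_fst_le p
    have h2 : ‖p.2‖ ≤ ‖p‖ := norm_snd_le p
    simp only [hL, Prod.norm_def, ContinuousLinearMap.prod_apply, smul_apply,
      ContinuousLinearMap.coe_fst', ContinuousLinearMap.coe_snd', norm_smul, norm_mul,
      Real.norm_eq_abs, abs_abs, abs_of_pos Real.pi_pos, abs_two] at h1 h2 ⊢
    refine max_le ?_ ?_
    · rw [mul_assoc (2 * Real.pi), mul_assoc (2 * Real.pi), mul_assoc (2 * Real.pi),
        mul_assoc (2 * Real.pi)]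
      gcongr
      exact le_max_left _ _
    · calc 2 * Real.pi * |(k : ℝ)| * |p.2| = 2 * Real.pi * 1 * |(k : ℝ)| * |p.2| := by ring
        _ ≤ _ := by
          gcongr
          exact le_max_right _ _
  refine ⟨fun k => hcomp k ▸ hQb.1.comp (L k).contDiff, fun m => ?_⟩
  obtain ⟨C, hC⟩ := hQb.2 m
  have hC0 : 0 ≤ C := (norm_nonneg _).trans (hC 0)
  refine ⟨C * (2 * Real.pi * max |μ| 1) ^ m, fun k p => ?_⟩
  rw [hcomp]
  refine (norm_iteratedFDeriv_comp_clm_le hQb.1 (L k) m p).trans ?_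
  rw [mul_assoc, ← mul_pow]
  gcongr
  · exact hC _
  · exact hLn k

theorem contDiff_stripSeries (μ : ℝ) {E : ℝ → ℝ} (hE : BoundedDerivs E) {a : ℤ → ℂ}
    (ha : RapidDecay a) : ContDiff ℝ (⊤ : ℕ∞) (stripSeries μ E a) := by
  obtain ⟨hs, hb⟩ := exists_norm_iteratedFDeriv_stripMode_le μ hE
  choose C hC using hb
  refine contDiff_tsum (v := fun m (k : ℤ) => C m * (|(k : ℝ)| ^ m * ‖a k‖))
    (fun k => contDiff_const.mul (hs k)) (fun m _ => (ha m).mul_left _) fun m k p _ => ?_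
  have : (fun p => a k * stripMode μ E k p) = a k • stripMode μ E k := rfl
  rw [this, iteratedFDeriv_const_smul_apply ((hs k).contDiffAt.of_le (by exact_mod_cast le_top)),
    norm_smul]
  calc ‖a k‖ * ‖iteratedFDeriv ℝ m (stripMode μ E k) p‖ ≤ ‖a k‖ * (C m * |(k : ℝ)| ^ m) := by
        gcongr; exact hC m k p
    _ = _ := by ring

theorem hasDerivAt_stripSeries_fst (μ : ℝ) {E : ℝ → ℝ} (hE : BoundedDerivs E) {a : ℤ → ℂ}
    (ha : RapidDecay a) (s y : ℝ) : HasDerivAt (fun r => stripSeries μ E a (r, y))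
      (stripSeries μ (deriv E) (fun k => (2 * Real.pi * μ * |(k : ℝ)| : ℝ) * a k) (s, y)) s := by
  obtain ⟨C, hC0, hC⟩ := hE.deriv.norm_le
  have hb : RapidDecay fun k => (2 * Real.pi * μ * |(k : ℝ)| : ℝ) * a k :=
    ha.of_norm_le (C := |2 * Real.pi * μ|) (j := 1) fun k => by
      rw [norm_mul, Complex.norm_real, Real.norm_eq_abs, abs_mul _ |(k : ℝ)|, abs_abs, pow_one]
  unfold stripSeries
  refine hasDerivAt_tsum (g := fun k r => a k * stripMode μ E k (r, y))
    (g' := fun k r => (2 * Real.pi * μ * |(k : ℝ)| : ℝ) * a k * stripMode μ (deriv E) k (r, y))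
    (hb.summable_norm.mul_right C) (fun k r => ?_) (fun k r => ?_)
    (summable_stripSeries hE ha (s, y)) s
  · have h1 : HasDerivAt E (deriv E (2 * Real.pi * μ * |(k : ℝ)| * r))
        (2 * Real.pi * μ * |(k : ℝ)| * r) := (hE.1.differentiable (by simp) _).hasDerivAt
    have h2 : HasDerivAt (fun r => 2 * Real.pi * μ * |(k : ℝ)| * r) (2 * Real.pi * μ * |(k : ℝ)|) r := by
      simpa using (hasDerivAt_id r).const_mul (2 * Real.pi * μ * |(k : ℝ)|)
    have h3 := (((h1.comp r h2).ofReal_comp).mul_const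
      (Complex.exp (((2 * Real.pi * k * y : ℝ) : ℂ) * Complex.I))).const_mul (a k)
    refine h3.congr_deriv ?_
    simp only [stripMode, Complex.ofReal_mul]
    ring
  · rw [norm_mul]
    gcongr
    exact norm_stripMode_le hC k _

theorem hasDerivAt_stripSeries_snd (μ : ℝ) {E : ℝ → ℝ} (hE : BoundedDerivs E) {a : ℤ → ℂ}
    (ha : RapidDecay a) (s y : ℝ) : HasDerivAt (fun r => stripSeries μ E a (s, r))
      (stripSeries μ E (fun k => (2 * Real.pi * k : ℝ) * Complex.I * a k) (s, y)) y := by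
  obtain ⟨C, hC0, hC⟩ := hE.norm_le
  have hb : RapidDecay fun k => (2 * Real.pi * k : ℝ) * Complex.I * a k :=
    ha.of_norm_le (C := |2 * Real.pi|) (j := 1) fun k => by
      rw [norm_mul, norm_mul, Complex.norm_real, Real.norm_eq_abs, abs_mul _ (k : ℝ),
        Complex.norm_I, pow_one, mul_one]
  unfold stripSeries
  refine hasDerivAt_tsum (g := fun k r => a k * stripMode μ E k (s, r))
    (g' := fun k r => (2 * Real.pi * k : ℝ) * Complex.I * a k * stripMode μ E k (s, r))
    (hb.summable_norm.mul_right C) (fun k r => ?_) (fun k r => ?_)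
    (summable_stripSeries hE ha (s, y)) y
  · have h2 : HasDerivAt (fun r => 2 * Real.pi * k * r) (2 * Real.pi * k) r := by
      simpa using (hasDerivAt_id r).const_mul (2 * Real.pi * k)
    have h3 := ((((h2.ofReal_comp).mul_const Complex.I).cexp).const_mul
      (E (2 * Real.pi * μ * |(k : ℝ)| * s) : ℂ)).const_mul (a k)
    refine h3.congr_deriv ?_
    simp only [stripMode]
    ring
  · rw [norm_mul]
    gcongr
    exact norm_stripMode_le hC k _

theorem stripSeries_add_one (μ : ℝ) (E : ℝ → ℝ) (a : ℤ → ℂ) (s y : ℝ) :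
    stripSeries μ E a (s, y + 1) = stripSeries μ E a (s, y) := by
  refine tsum_congr fun k => ?_
  simp only [stripMode]
  congr 2
  rw [← Complex.exp_periodic.int_mul k (((2 * Real.pi * k * y : ℝ) : ℂ) * Complex.I)]
  congr 1
  push_cast
  ring

theorem HasDerivAt.complex_re {f : ℝ → ℂ} {f' : ℂ} {x : ℝ} (h : HasDerivAt f f' x) :
    HasDerivAt (fun r => (f r).re) f'.re x :=
  Complex.reCLM.hasFDerivAt.comp_hasDerivAt x h

/-- The real part of `stripSeries` with profile `exp (-r)` solves the scaled Laplace equation. -/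
theorem exists_decaying_solution {μ : ℝ} (hμ : 0 ≤ μ) {a : ℤ → ℂ} (ha : RapidDecay a) :
    ∃ h : ℝ × ℝ → ℝ, ContDiff ℝ (⊤ : ℕ∞) h ∧ (∀ s y, h (s, y + 1) = h (s, y)) ∧
      (∀ s y, 0 ≤ s → partialFst (partialFst h) (s, y) + μ ^ 2 * partialSnd (partialSnd h) (s, y)
        = 0) ∧
      ∀ s y, 0 ≤ s → HasSum (fun k : ℤ => (a k * Real.exp (-(2 * Real.pi * μ * |(k : ℝ)| * s)) *
        Complex.exp (((2 * Real.pi * k * y : ℝ) : ℂ) * Complex.I)).re) (h (s, y)) := by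
  have hE := boundedDerivs_decayProfile
  have smooth : ∀ {E : ℝ → ℝ} (_ : BoundedDerivs E) {b : ℤ → ℂ} (_ : RapidDecay b),
      ContDiff ℝ (⊤ : ℕ∞) fun p => (stripSeries μ E b p).re := fun hE _ hb =>
    Complex.reCLM.contDiff.comp (contDiff_stripSeries μ hE hb)
  have hb1 : ∀ {b : ℤ → ℂ}, RapidDecay b →
      RapidDecay fun k => (2 * Real.pi * μ * |(k : ℝ)| : ℝ) * b k := fun hb =>
    hb.of_norm_le (C := |2 * Real.pi * μ|) (j := 1) fun k => by
      rw [norm_mul, Complex.norm_real, Real.norm_eq_abs, abs_mul _ |(k : ℝ)|, abs_abs, pow_one]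
  have hb2 : ∀ {b : ℤ → ℂ}, RapidDecay b →
      RapidDecay fun k => (2 * Real.pi * k : ℝ) * Complex.I * b k := fun hb =>
    hb.of_norm_le (C := |2 * Real.pi|) (j := 1) fun k => by
      rw [norm_mul, norm_mul, Complex.norm_real, Real.norm_eq_abs, abs_mul _ (k : ℝ),
        Complex.norm_I, pow_one, mul_one]
  have d1 : ∀ {E : ℝ → ℝ} (_ : BoundedDerivs E) {b : ℤ → ℂ} (_ : RapidDecay b),
      (partialFst fun p => (stripSeries μ E b p).re) = fun p => (stripSeries μ (deriv E)
        (fun k => (2 * Real.pi * μ * |(k : ℝ)| : ℝ) * b k) p).re := fun hE _ hb => by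
    ext ⟨s, y⟩
    exact partialFst_eq ((smooth hE hb).differentiable (by simp) _)
      (hasDerivAt_stripSeries_fst μ hE hb s y).complex_re
  have d2 : ∀ {E : ℝ → ℝ} (_ : BoundedDerivs E) {b : ℤ → ℂ} (_ : RapidDecay b),
      (partialSnd fun p => (stripSeries μ E b p).re) = fun p => (stripSeries μ E
        (fun k => (2 * Real.pi * k : ℝ) * Complex.I * b k) p).re := fun hE _ hb => by
    ext ⟨s, y⟩
    exact partialSnd_eq ((smooth hE hb).differentiable (by simp) _)
      (hasDerivAt_stripSeries_snd μ hE hb s y).complex_re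
  refine ⟨fun p => (stripSeries μ decayProfile a p).re, smooth hE ha, fun s y => ?_,
    fun s y hs => ?_, fun s y hs => ?_⟩
  · simp only [stripSeries_add_one]
  · rw [d1 hE ha, d1 hE.deriv (hb1 ha), d2 hE ha, d2 hE (hb2 ha)]
    simp only
    rw [← Complex.re_ofReal_mul, ← Complex.add_re]
    convert Complex.zero_re
    rw [stripSeries, stripSeries, ← tsum_mul_left,
      ← (summable_stripSeries hE.deriv.deriv (hb1 (hb1 ha)) (s, y)).tsum_add
        ((summable_stripSeries hE (hb2 (hb2 ha)) (s, y)).mul_left _)]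
    refine (tsum_congr fun k => ?_).trans tsum_zero
    have hr : 0 ≤ 2 * Real.pi * μ * |(k : ℝ)| * s := by positivity
    have hE2 : deriv (deriv decayProfile) (2 * Real.pi * μ * |(k : ℝ)| * s) =
        decayProfile (2 * Real.pi * μ * |(k : ℝ)| * s) := by
      have := iteratedDeriv_decayProfile 2 (r := 2 * Real.pi * μ * |(k : ℝ)| * s) (by linarith)
      rw [iteratedDeriv_succ, iteratedDeriv_one] at this
      rw [this, decayProfile_of_ge (by linarith)]
      norm_num
    have habs : ((|(k : ℝ)| : ℝ) : ℂ) ^ 2 = (k : ℂ) ^ 2 := by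
      rw [← Complex.ofReal_pow, sq_abs]; push_cast; rfl
    simp only [stripMode, hE2]
    push_cast
    linear_combination 4 * (Real.pi : ℂ) ^ 2 * μ ^ 2 * a k *
      (decayProfile (2 * Real.pi * μ * |(k : ℝ)| * s) : ℂ) *
      Complex.exp (2 * Real.pi * k * y * Complex.I) * (habs + (k : ℂ) ^ 2 * Complex.I_sq)
  · refine (Complex.hasSum_re (summable_stripSeries (μ := μ) hE ha (s, y)).hasSum).congr_fun
      fun k => ?_
    have hr : 0 ≤ 2 * Real.pi * μ * |(k : ℝ)| * s := by positivity
    simp only [stripMode]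
    rw [decayProfile_of_ge (by linarith), mul_assoc]

theorem periodic_deriv {E : Type*} [NormedAddCommGroup E] [NormedSpace ℝ E] {f : ℝ → E} {c : ℝ}
    (hf : Function.Periodic f c) : Function.Periodic (deriv f) c := fun y => by
  rw [← deriv_comp_add_const]
  congr 1
  exact funext hf

theorem exists_pow_mul_norm_fourierCoeffOn_le (m : ℕ) : ∀ {φ : ℝ → ℂ},
    ContDiff ℝ (⊤ : ℕ∞) φ → Function.Periodic φ 1 →
    ∃ C : ℝ, ∀ k : ℤ, |(k : ℝ)| ^ m * ‖fourierCoeffOn zero_lt_one φ k‖ ≤ C := by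
  induction m with
  | zero =>
    intro φ hφ _
    obtain ⟨C, hC⟩ := (isCompact_Icc (a := (0 : ℝ)) (b := 1)).exists_bound_of_continuousOn
      hφ.continuous.continuousOn
    refine ⟨C, fun k => ?_⟩
    rw [pow_zero, one_mul, fourierCoeffOn_eq_integral]
    simp only [sub_zero, div_one, one_smul]
    refine (intervalIntegral.norm_integral_le_of_norm_le_const (C := C) fun x hx => ?_).trans
      (by simp)
    rw [Set.uIoc_of_le zero_le_one] at hx
    rw [smul_eq_mul, norm_mul, fourier_apply, Circle.norm_coe, one_mul]
    exact hC x ⟨hx.1.le, hx.2⟩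
  | succ m ih =>
    intro φ hφ hper
    obtain ⟨C, hC⟩ := ih (contDiff_infty_iff_deriv.1 hφ).2 (periodic_deriv hper)
    refine ⟨max 0 C, fun k => ?_⟩
    rcases eq_or_ne k 0 with rfl | hk
    · simp
    refine le_trans ?_ (le_max_right _ _)
    have hd : Continuous (deriv φ) := (contDiff_infty_iff_deriv.1 hφ).2.continuous
    have h := fourierCoeffOn_of_hasDerivAt zero_lt_one (f := φ) (f' := deriv φ) hk
      (fun x _ => (hφ.differentiable (by simp) x).hasDerivAt) (hd.intervalIntegrable _ _)
    have hp1 : φ 1 = φ 0 := by simpa using hper 0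
    rw [hp1, sub_self, mul_zero, zero_sub] at h
    have hn : 2 * Real.pi * |(k : ℝ)| * ‖fourierCoeffOn zero_lt_one φ k‖ =
        ‖fourierCoeffOn zero_lt_one (deriv φ) k‖ := by
      have hk' : |(k : ℝ)| ≠ 0 := by simpa using hk
      rw [h]
      simp [abs_of_pos Real.pi_pos]
      field_simp
    calc |(k : ℝ)| ^ (m + 1) * ‖fourierCoeffOn zero_lt_one φ k‖
        = |(k : ℝ)| ^ m * (1 * |(k : ℝ)| * ‖fourierCoeffOn zero_lt_one φ k‖) := by ring
      _ ≤ |(k : ℝ)| ^ m * (2 * Real.pi * |(k : ℝ)| * ‖fourierCoeffOn zero_lt_one φ k‖) := by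
        gcongr
        linarith [Real.pi_gt_three]
      _ ≤ C := by rw [hn]; exact hC k

theorem exists_fourier_expansion {φ : ℝ → ℝ} (hφ : ContDiff ℝ (⊤ : ℕ∞) φ)
    (hper : Function.Periodic φ 1) : ∃ a : ℤ → ℂ, RapidDecay a ∧ ∀ y, HasSum (fun k : ℤ =>
      (a k * Complex.exp (((2 * Real.pi * k * y : ℝ) : ℂ) * Complex.I)).re) (φ y) := by
  set f : ℝ → ℂ := fun y => (φ y : ℂ) with hf
  have hfs : ContDiff ℝ (⊤ : ℕ∞) f := Complex.ofRealCLM.contDiff.comp hφ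
  have hfp : Function.Periodic f 1 := fun y => by simp only [hf, hper y]
  have hdecay : RapidDecay (fourierCoeffOn zero_lt_one f) := fun m => by
    obtain ⟨C, hC⟩ := exists_pow_mul_norm_fourierCoeffOn_le (m + 2) hfs hfp
    refine Summable.of_norm_bounded_eventually (g := fun k : ℤ => C * (1 / (k : ℝ) ^ 2))
      ((Real.summable_one_div_int_pow.2 one_lt_two).mul_left C) ?_
    refine (Set.finite_singleton (0 : ℤ)).subset fun k hk => ?_
    by_contra hk0
    refine hk ?_
    change ‖|(k : ℝ)| ^ m * ‖fourierCoeffOn zero_lt_one f k‖‖ ≤ C * (1 / (k : ℝ) ^ 2)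
    have hk0 : (k : ℝ) ≠ 0 := by simpa using hk0
    rw [Real.norm_of_nonneg (by positivity), mul_one_div, le_div_iff₀ (by positivity)]
    calc _ = |(k : ℝ)| ^ (m + 2) * ‖fourierCoeffOn zero_lt_one f k‖ := by
          rw [pow_add, sq_abs]; ring
      _ ≤ C := hC k
  refine ⟨_, hdecay, fun y => ?_⟩
  have : Fact ((0 : ℝ) < 1) := ⟨zero_lt_one⟩
  set F : C(AddCircle (1 : ℝ), ℂ) := ⟨hfp.lift, continuous_coinduced_dom.mpr hfs.continuous⟩ with hF
  have hcoef : ∀ k, fourierCoeff F k = fourierCoeffOn zero_lt_one f k := fun k => by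
    rw [fourierCoeff_eq_intervalIntegral _ _ 0, fourierCoeffOn_eq_integral]
    simp [hF]
  have hsum : Summable (fourierCoeff F) := by
    rw [funext hcoef]
    exact hdecay.summable_norm.of_norm
  have h := Complex.hasSum_re (has_pointwise_sum_fourier_series_of_summable hsum (y : AddCircle (1 : ℝ)))
  have hFy : (F (y : AddCircle (1 : ℝ))).re = φ y := by simp [hF, hf]
  rw [hFy] at h
  refine h.congr_fun fun k => ?_
  rw [hcoef, fourier_coe_apply, smul_eq_mul]
  congr 3
  push_cast
  ring

theorem partialFst_add {f g : ℝ × ℝ → ℝ} (hf : ContDiff ℝ (⊤ : ℕ∞) f)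
    (hg : ContDiff ℝ (⊤ : ℕ∞) g) :
    partialFst (fun p => f p + g p) = fun p => partialFst f p + partialFst g p := by
  ext p
  simp only [partialFst]
  rw [fderiv_fun_add (hf.differentiable (by simp) p) (hg.differentiable (by simp) p)]
  rfl

theorem partialSnd_add {f g : ℝ × ℝ → ℝ} (hf : ContDiff ℝ (⊤ : ℕ∞) f)
    (hg : ContDiff ℝ (⊤ : ℕ∞) g) :
    partialSnd (fun p => f p + g p) = fun p => partialSnd f p + partialSnd g p := by
  ext p
  simp only [partialSnd]
  rw [fderiv_fun_add (hf.differentiable (by simp) p) (hg.differentiable (by simp) p)]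
  rfl

theorem partialFst_reflect {f : ℝ × ℝ → ℝ} (hf : ContDiff ℝ (⊤ : ℕ∞) f) (T : ℝ) :
    partialFst (fun p => f (T - p.1, p.2)) = fun p => -partialFst f (T - p.1, p.2) := by
  ext ⟨s, y⟩
  refine partialFst_eq ((hf.comp (by fun_prop : ContDiff ℝ (⊤ : ℕ∞)
    fun p : ℝ × ℝ => (T - p.1, p.2))).differentiable (by simp) _) ?_
  have h := (hasDerivAt_slice_fst (hf.differentiable (by simp) (T - s, y)))
  exact (h.comp s ((hasDerivAt_id s).const_sub T)).congr_deriv (by ring)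

theorem partialSnd_reflect {f : ℝ × ℝ → ℝ} (hf : ContDiff ℝ (⊤ : ℕ∞) f) (T : ℝ) :
    partialSnd (fun p => f (T - p.1, p.2)) = fun p => partialSnd f (T - p.1, p.2) := by
  ext ⟨s, y⟩
  exact partialSnd_eq ((hf.comp (by fun_prop : ContDiff ℝ (⊤ : ℕ∞)
    fun p : ℝ × ℝ => (T - p.1, p.2))).differentiable (by simp) _)
    (hasDerivAt_slice_snd (hf.differentiable (by simp) (T - s, y)))

/-- The periodic Dirichlet problem for the scaled Laplace equation on a strip. -/
theorem exists_strip_dirichlet {μ T : ℝ} (hμ : 0 < μ) (hT : 0 < T) {φ₀ φ₁ : ℝ → ℝ}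
    (h₀ : ContDiff ℝ (⊤ : ℕ∞) φ₀) (h₁ : ContDiff ℝ (⊤ : ℕ∞) φ₁)
    (hp₀ : Function.Periodic φ₀ 1) (hp₁ : Function.Periodic φ₁ 1) :
    ∃ h : ℝ × ℝ → ℝ, ContDiff ℝ (⊤ : ℕ∞) h ∧ (∀ s y, h (s, y + 1) = h (s, y)) ∧
      (∀ y, h (0, y) = φ₀ y) ∧ (∀ y, h (T, y) = φ₁ y) ∧
      ∀ s ∈ Set.Icc 0 T, ∀ y, partialFst (partialFst h) (s, y) +
        μ ^ 2 * partialSnd (partialSnd h) (s, y) = 0 := by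
  obtain ⟨a, ha, hsa⟩ := exists_fourier_expansion h₀ hp₀
  obtain ⟨b, hb, hsb⟩ := exists_fourier_expansion h₁ hp₁
  set e : ℤ → ℝ := fun k => Real.exp (-(2 * Real.pi * μ * |(k : ℝ)| * T)) with he
  set q : ℝ := Real.exp (-(2 * Real.pi * μ * T)) with hq
  have hq1 : q < 1 := Real.exp_lt_one_iff.2 (by have := Real.pi_pos; simp; positivity)
  have hq0 : 0 < q := Real.exp_pos _
  have heq : ∀ k : ℤ, k ≠ 0 → e k ≤ q := fun k hk => by
    have h1 : (1 : ℝ) ≤ |(k : ℝ)| := by exact_mod_cast Int.one_le_abs hk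
    refine Real.exp_le_exp.2 (neg_le_neg ?_)
    have : 0 ≤ 2 * Real.pi * μ * T := by have := Real.pi_pos; positivity
    nlinarith
  have he0 : ∀ k, 0 < e k := fun k => Real.exp_pos _
  have hden : ∀ k : ℤ, k ≠ 0 → 1 - q ^ 2 ≤ 1 - e k ^ 2 := fun k hk => by
    nlinarith [heq k hk, he0 k]
  have hq2 : 0 < 1 - q ^ 2 := by nlinarith
  set C := (1 - q ^ 2)⁻¹ with hC
  have hC0 : 0 < C := inv_pos.2 hq2
  have hα : ∀ k : ℤ, k ≠ 0 → |(1 - e k ^ 2)⁻¹| ≤ C := fun k hk => by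
    have := hden k hk
    rw [abs_of_pos (inv_pos.2 (by linarith))]
    exact inv_anti₀ hq2 this
  have hβ : ∀ k : ℤ, k ≠ 0 → |e k * (1 - e k ^ 2)⁻¹| ≤ C := fun k hk => by
    rw [abs_mul, abs_of_pos (he0 k)]
    have := hα k hk
    have := heq k hk
    nlinarith [abs_nonneg (1 - e k ^ 2)⁻¹]
  have aux : ∀ {x : ℤ → ℂ} (_ : RapidDecay x) (γ : ℤ → ℝ) (_ : ∀ k, |γ k| ≤ max C 1),
      RapidDecay fun k => (γ k : ℂ) * x k := fun hx γ hγ =>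
    hx.of_norm_le (C := max C 1) (j := 0) fun k => by
      rw [norm_mul, Complex.norm_real, pow_zero, mul_one]
      exact mul_le_mul_of_nonneg_right (hγ k) (norm_nonneg _)
  have hA : RapidDecay fun k => ((if k = 0 then 1 else (1 - e k ^ 2)⁻¹ : ℝ) : ℂ) * a k +
      ((if k = 0 then 0 else -(e k * (1 - e k ^ 2)⁻¹) : ℝ) : ℂ) * b k := by
    refine (aux ha _ fun k => ?_).add (aux hb _ fun k => ?_) <;> split_ifs with hk
    · simp
    · exact (hα k hk).trans (le_max_left _ _)
    · simp
    · rw [abs_neg]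
      exact (hβ k hk).trans (le_max_left _ _)
  have hB : RapidDecay fun k => ((if k = 0 then 0 else (1 - e k ^ 2)⁻¹ : ℝ) : ℂ) * b k +
      ((if k = 0 then 0 else -(e k * (1 - e k ^ 2)⁻¹) : ℝ) : ℂ) * a k := by
    refine (aux hb _ fun k => ?_).add (aux ha _ fun k => ?_) <;> split_ifs with hk
    · simp
    · exact (hα k hk).trans (le_max_left _ _)
    · simp
    · rw [abs_neg]
      exact (hβ k hk).trans (le_max_left _ _)
  obtain ⟨f, hfs, hfp, hfe, hfv⟩ := exists_decaying_solution hμ.le hA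
  obtain ⟨g, hgs, hgp, hge, hgv⟩ := exists_decaying_solution hμ.le hB
  set δ : ℝ := (b 0 - a 0).re with hδ
  have hgr : ContDiff ℝ (⊤ : ℕ∞) fun p : ℝ × ℝ => g (T - p.1, p.2) :=
    hgs.comp (by fun_prop : ContDiff ℝ (⊤ : ℕ∞) fun p : ℝ × ℝ => (T - p.1, p.2))
  have hl : ContDiff ℝ (⊤ : ℕ∞) fun p : ℝ × ℝ => δ / T * p.1 := by fun_prop
  have hfg : ContDiff ℝ (⊤ : ℕ∞) fun p : ℝ × ℝ => f p + g (T - p.1, p.2) := hfs.add hgr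
  refine ⟨fun p => (f p + g (T - p.1, p.2)) + δ / T * p.1, hfg.add hl, fun s y => ?_, fun y => ?_,
    fun y => ?_, fun s hs y => ?_⟩
  · simp only [hfp, hgp]
  · have h1 := (hfv 0 y le_rfl).add (hgv T y hT.le)
    simp only [sub_zero, mul_zero, add_zero]
    refine h1.unique ((hsa y).congr_fun fun k => ?_)
    rw [← Complex.add_re, ← add_mul]
    congr 2
    by_cases hk : k = 0
    · subst hk; simp
    · have hd : (1 : ℂ) - (e k : ℂ) ^ 2 ≠ 0 := by
        have := hden k hk
        have h2 : 1 - e k ^ 2 ≠ 0 := by linarith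
        exact_mod_cast h2
      simp only [hk, if_false, neg_zero, mul_zero, Real.exp_zero, Complex.ofReal_one, mul_one]
      change _ + _ * ((e k : ℝ) : ℂ) = _
      push_cast
      field_simp
      ring
  · have h1 := ((hfv T y hT.le).add (hgv 0 y le_rfl)).add (hasSum_ite_eq (0 : ℤ) δ)
    simp only [sub_self]
    rw [div_mul_cancel₀ _ hT.ne']
    refine h1.unique ((hsb y).congr_fun fun k => ?_)
    rw [← Complex.add_re, ← add_mul]
    by_cases hk : k = 0
    · subst hk; simp [hδ]
    · have hd : (1 : ℂ) - (e k : ℂ) ^ 2 ≠ 0 := by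
        have := hden k hk
        have h2 : 1 - e k ^ 2 ≠ 0 := by linarith
        exact_mod_cast h2
      simp only [hk, if_false, neg_zero, mul_zero, Real.exp_zero, Complex.ofReal_one, mul_one,
        add_zero]
      congr 2
      change _ * ((e k : ℝ) : ℂ) + _ = _
      push_cast
      field_simp
      ring
  · have l1 : partialFst (fun p : ℝ × ℝ => δ / T * p.1) = fun _ => δ / T := by
      ext ⟨s, y⟩
      exact partialFst_eq (hl.differentiable (by simp) _)
        (by simpa using (hasDerivAt_id s).const_mul (δ / T))
    have l2 : partialSnd (fun p : ℝ × ℝ => δ / T * p.1) = fun _ => 0 := by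
      ext ⟨s, y⟩
      exact partialSnd_eq (hl.differentiable (by simp) _) (hasDerivAt_const y (δ / T * s))
    have l3 : ∀ c : ℝ, partialFst (fun _ : ℝ × ℝ => c) = fun _ => 0 := fun c => by
      ext p; simp [partialFst]
    have l4 : partialSnd (fun _ : ℝ × ℝ => (0 : ℝ)) = fun _ => 0 := by
      ext p; simp [partialSnd]
    have hgr1 : ContDiff ℝ (⊤ : ℕ∞) fun p : ℝ × ℝ => partialFst g (T - p.1, p.2) :=
      hgs.partialFst.comp (by fun_prop : ContDiff ℝ (⊤ : ℕ∞) fun p : ℝ × ℝ => (T - p.1, p.2))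
    have hgr2 : ContDiff ℝ (⊤ : ℕ∞) fun p : ℝ × ℝ => partialSnd g (T - p.1, p.2) :=
      hgs.partialSnd.comp (by fun_prop : ContDiff ℝ (⊤ : ℕ∞) fun p : ℝ × ℝ => (T - p.1, p.2))
    have l5 : partialFst (fun p : ℝ × ℝ => -partialFst g (T - p.1, p.2)) =
        fun p => partialFst (partialFst g) (T - p.1, p.2) := by
      have := partialFst_reflect hgs.partialFst T
      ext p
      have h2 := congrFun this p
      simp only [partialFst] at h2 ⊢
      rw [fderiv_fun_neg, neg_apply, h2, neg_neg]
    have e1 := hfe s y hs.1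
    have e2 := hge (T - s) y (by linarith [hs.2])
    rw [partialFst_add hfg hl, partialFst_add hfs hgr, partialFst_reflect hgs, l1,
      partialFst_add (hfs.partialFst.add hgr1.neg) contDiff_const,
      partialFst_add hfs.partialFst hgr1.neg, l5, l3,
      partialSnd_add hfg hl, partialSnd_add hfs hgr, partialSnd_reflect hgs, l2,
      partialSnd_add (hfs.partialSnd.add hgr2) contDiff_const,
      partialSnd_add hfs.partialSnd hgr2, partialSnd_reflect hgs.partialSnd, l4]
    simp only
    linarith

theorem deriv_deriv_nonneg_of_isLocalMin {f : ℝ → ℝ} {x : ℝ} (hc : ContinuousAt f x)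
    (h : IsLocalMin f x) : 0 ≤ deriv (deriv f) x := by
  by_contra! hneg
  have hmax := isLocalMax_of_deriv_deriv_neg hneg h.deriv_eq_zero hc
  have hconst : f =ᶠ[nhds x] fun _ => f x := by
    filter_upwards [h, hmax] with y h1 h2
    exact le_antisymm h2 h1
  have : deriv (deriv f) x = 0 := by
    rw [hconst.deriv.deriv_eq]
    simp
  linarith

/-- The weak maximum principle for periodic solutions on a strip. -/
theorem pos_of_strip_dirichlet {μ T : ℝ} (hT : 0 < T) {m : ℝ × ℝ → ℝ}
    (hm : ContDiff ℝ (⊤ : ℕ∞) m) (hper : ∀ s y, m (s, y + 1) = m (s, y))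
    (h0 : ∀ y, 0 < m (0, y)) (h1 : ∀ y, 0 < m (T, y))
    (heq : ∀ s ∈ Set.Icc 0 T, ∀ y, partialFst (partialFst m) (s, y) +
        μ ^ 2 * partialSnd (partialSnd m) (s, y) = 0) :
    ∀ s ∈ Set.Icc 0 T, ∀ y, 0 < m (s, y) := by
  intro s₀ hs₀ y₀
  by_contra! hneg
  have hcont := hm.continuous
  have red : ∀ s y, ∃ y' ∈ Set.Icc (0 : ℝ) 1, m (s, y) = m (s, y') := fun s y => by
    obtain ⟨y', hy', h⟩ := (show Function.Periodic (fun y => m (s, y)) 1 from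
      fun y => hper s y).exists_mem_Ico₀ zero_lt_one y
    exact ⟨y', ⟨hy'.1, hy'.2.le⟩, h⟩
  have bdry : ∀ r, (∀ y, 0 < m (r, y)) → ∃ c > 0, ∀ y, c ≤ m (r, y) := fun r hr => by
    obtain ⟨y', -, hmin⟩ := (isCompact_Icc (a := (0 : ℝ)) (b := 1)).exists_isMinOn
      (Set.nonempty_Icc.2 zero_le_one) (f := fun y => m (r, y)) (by fun_prop)
    refine ⟨m (r, y'), hr y', fun y => ?_⟩
    obtain ⟨z, hz, h⟩ := red r y
    rw [h]
    exact hmin hz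
  obtain ⟨c₀, hc₀, hb₀⟩ := bdry 0 h0
  obtain ⟨c₁, hc₁, hb₁⟩ := bdry T h1
  set ε := c₁ / (2 * T ^ 2) with hε
  have hε0 : 0 < ε := by positivity
  have hεT : ε * T ^ 2 = c₁ / 2 := by rw [hε]; field_simp
  obtain ⟨⟨s, y⟩, ⟨hs, -⟩, hmin⟩ := ((isCompact_Icc (a := (0 : ℝ)) (b := T)).prod
    (isCompact_Icc (a := (0 : ℝ)) (b := 1))).exists_isMinOn
    ⟨((0 : ℝ), (0 : ℝ)), by constructor <;> simp [hT.le]⟩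
    (f := fun p : ℝ × ℝ => m p - ε * p.1 ^ 2) (by fun_prop)
  have hglob : ∀ r ∈ Set.Icc 0 T, ∀ z, m (s, y) - ε * s ^ 2 ≤ m (r, z) - ε * r ^ 2 := by
    intro r hr z
    obtain ⟨z', hz', h⟩ := red r z
    rw [h]
    exact hmin (show (r, z') ∈ Set.Icc 0 T ×ˢ Set.Icc 0 1 from ⟨hr, hz'⟩)
  have hle : m (s, y) - ε * s ^ 2 ≤ 0 :=
    (hglob s₀ hs₀ y₀).trans (by nlinarith [sq_nonneg s₀])
  have hs0 : s ≠ 0 := by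
    rintro rfl
    have := h0 y
    nlinarith
  have hsT : s ≠ T := by
    rintro rfl
    have := hb₁ y
    nlinarith
  have hsI : s ∈ Set.Ioo 0 T := ⟨lt_of_le_of_ne hs.1 hs0.symm, lt_of_le_of_ne hs.2 hsT⟩
  have hd : Differentiable ℝ m := hm.differentiable (by simp)
  have hdd1 : Differentiable ℝ (partialFst m) := hm.partialFst.differentiable (by simp)
  have hdd2 : Differentiable ℝ (partialSnd m) := hm.partialSnd.differentiable (by simp)
  have k1 : 0 ≤ deriv (deriv fun r => m (r, y) - ε * r ^ 2) s := by
    refine deriv_deriv_nonneg_of_isLocalMin (by fun_prop) ?_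
    filter_upwards [Ioo_mem_nhds hsI.1 hsI.2] with r hr
    exact hglob r ⟨hr.1.le, hr.2.le⟩ y
  have k2 : 0 ≤ deriv (deriv fun z => m (s, z)) y := by
    refine deriv_deriv_nonneg_of_isLocalMin (by fun_prop) (Filter.Eventually.of_forall fun z => ?_)
    have := hglob s hs z
    linarith
  have e1 : (deriv fun r => m (r, y) - ε * r ^ 2) = fun r => partialFst m (r, y) - ε * (2 * r) := by
    ext r
    refine ((hasDerivAt_slice_fst (hd (r, y))).sub (((hasDerivAt_pow 2 r)).const_mul ε)).deriv.trans
      ?_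
    simp
  have e2 : (deriv fun z => m (s, z)) = fun z => partialSnd m (s, z) := by
    ext z
    exact (hasDerivAt_slice_snd (hd (s, z))).deriv
  have e3 : deriv (fun r => partialFst m (r, y) - ε * (2 * r)) s =
      partialFst (partialFst m) (s, y) - ε * 2 := by
    refine ((hasDerivAt_slice_fst (hdd1 (s, y))).sub
      (((hasDerivAt_id s).const_mul 2).const_mul ε)).deriv.trans ?_
    simp
  rw [e1, e3] at k1
  rw [e2, (hasDerivAt_slice_snd (hdd2 (s, y))).deriv] at k2
  have := heq s hs y
  nlinarith [mul_nonneg (sq_nonneg μ) k2]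

theorem contDiff_of_right_inverse {E : Type*} [NormedAddCommGroup E] [NormedSpace ℝ E]
    [CompleteSpace E] {Φ G : E → E} (hΦ : ContDiff ℝ (⊤ : ℕ∞) Φ) (hinj : Function.Injective Φ)
    (hG : ∀ z, Φ (G z) = z) (hd : ∀ z, ∃ e : E ≃L[ℝ] E, HasFDerivAt Φ (e : E →L[ℝ] E) z) :
    ContDiff ℝ (⊤ : ℕ∞) G := by
  refine contDiff_iff_contDiffAt.2 fun z => ?_
  obtain ⟨e, he⟩ := hd (G z)
  have h := hΦ.contDiffAt.to_localInverse he (by simp)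
  rw [hG z] at h
  refine h.congr_of_eventuallyEq ?_
  have hr := (hΦ.contDiffAt.hasStrictFDerivAt' he (by simp)).eventually_right_inverse
  rw [hG z] at hr
  filter_upwards [hr] with x hx
  exact hinj ((hG x).trans hx.symm)

theorem exists_inverse_of_deg_one {f f' : ℝ → ℝ} (hd : ∀ x, HasDerivAt f (f' x) x)
    (hpos : ∀ x, 0 < f' x) (hper : ∀ x, f (x + 1) = f x + 1) :
    Function.Injective f ∧ ∃ g : ℝ → ℝ, (∀ z, f (g z) = z) ∧ (∀ x, g (f x) = x) ∧
      ∀ z, g (z + 1) = g z + 1 := by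
  have hmono : StrictMono f := strictMono_of_deriv_pos fun x => by
    rw [(hd x).deriv]; exact hpos x
  have hc : Continuous f := continuous_iff_continuousAt.2 fun x => (hd x).continuousAt
  let F : CircleDeg1Lift := ⟨⟨f, hmono.monotone⟩, hper⟩
  have hsurj : Function.Surjective f := F.continuous_iff_surjective.1 hc
  choose g hg using hsurj
  refine ⟨hmono.injective, g, hg, fun x => hmono.injective (hg _), fun z => hmono.injective ?_⟩
  rw [hg, hper, hg]

theorem contDiff_deriv {f : ℝ → ℝ} (hf : ContDiff ℝ (⊤ : ℕ∞) f) :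
    ContDiff ℝ (⊤ : ℕ∞) (deriv f) :=
  (contDiff_infty_iff_deriv.1 hf).2

/-- The image of a curve potential `ψ` under the shear `(x, p) ↦ (x + t p, p)`. -/
theorem exists_sheared_potential {t : ℝ} {ψ : ℝ → ℝ} (hψ : ContDiff ℝ (⊤ : ℕ∞) ψ)
    (hper : Function.Periodic ψ 1) (hpos : ∀ x, 0 < 1 + t * deriv (deriv ψ) x) :
    ∃ φ : ℝ → ℝ, ContDiff ℝ (⊤ : ℕ∞) φ ∧ Function.Periodic φ 1 ∧
      (∀ y, 0 < 1 - t * deriv (deriv φ) y) ∧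
      ∀ y, ψ (y - t * deriv φ y) = φ y - t / 2 * deriv φ y ^ 2 := by
  have hψ1 := contDiff_deriv hψ
  have hper1 := periodic_deriv hper
  have d0 : ∀ x, HasDerivAt ψ (deriv ψ x) x := fun x => (hψ.differentiable (by simp) x).hasDerivAt
  have d1 : ∀ x, HasDerivAt (deriv ψ) (deriv (deriv ψ) x) x := fun x =>
    (hψ1.differentiable (by simp) x).hasDerivAt
  have hfd : ∀ x, HasDerivAt (fun x => x + t * deriv ψ x) (1 + t * deriv (deriv ψ) x) x :=
    fun x => (hasDerivAt_id x).add ((d1 x).const_mul t)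
  obtain ⟨hinj, g, hg, hg', hgp⟩ := exists_inverse_of_deg_one hfd hpos fun x => by
    rw [hper1 x]; ring
  have hgs : ContDiff ℝ (⊤ : ℕ∞) g :=
    contDiff_of_right_inverse (contDiff_id.add (contDiff_const.mul hψ1)) hinj hg fun z =>
      ⟨ContinuousLinearEquiv.unitsEquivAut ℝ (Units.mk0 _ (hpos z).ne'),
        (hfd z).hasFDerivAt.congr_fderiv (by ext; simp)⟩
  have dg : ∀ y, HasDerivAt g (1 + t * deriv (deriv ψ) (g y))⁻¹ y := fun y =>
    HasDerivAt.of_local_left_inverse hgs.continuous.continuousAt (hfd (g y)) (hpos _).ne'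
      (Filter.Eventually.of_forall hg)
  set φ : ℝ → ℝ := fun y => ψ (g y) + t / 2 * deriv ψ (g y) ^ 2 with hφ
  have hφ1 : deriv φ = fun y => deriv ψ (g y) := by
    ext y
    have h1 : HasDerivAt (fun y => ψ (g y)) _ y := (d0 (g y)).comp y (dg y)
    have h2 : HasDerivAt (fun y => deriv ψ (g y)) _ y := (d1 (g y)).comp y (dg y)
    refine (h1.add ((h2.pow 2).const_mul (t / 2))).deriv.trans ?_
    have := (hpos (g y)).ne'
    field_simp
    ring
  refine ⟨φ, (hψ.comp hgs).add (contDiff_const.mul ((hψ1.comp hgs).pow 2)), fun y => ?_,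
    fun y => ?_, fun y => ?_⟩
  · simp only [hφ, hgp, hper (g y), hper1 (g y)]
  · have h2 : HasDerivAt (fun y => deriv ψ (g y)) _ y := (d1 (g y)).comp y (dg y)
    rw [hφ1, h2.deriv]
    have := hpos (g y)
    have h3 : 1 - t * (deriv (deriv ψ) (g y) * (1 + t * deriv (deriv ψ) (g y))⁻¹) =
        (1 + t * deriv (deriv ψ) (g y))⁻¹ := by
      field_simp
      ring
    rw [h3]
    positivity
  · have : y - t * deriv ψ (g y) = g y := by linarith [hg y]
    rw [hφ1]
    simp only [this, hφ]
    ring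

theorem hasDerivAt_comp_shear_fst {G q : ℝ × ℝ → ℝ} {t s y : ℝ} (hG : ContDiff ℝ (⊤ : ℕ∞) G)
    (hq : ContDiff ℝ (⊤ : ℕ∞) q) : HasDerivAt (fun r => G (r, y - t * q (r, y)))
      (partialFst G (s, y - t * q (s, y)) -
        t * partialFst q (s, y) * partialSnd G (s, y - t * q (s, y))) s := by
  have h1 := (hasDerivAt_id s).prodMk (((hasDerivAt_slice_fst (y := y)
    (hq.differentiable (by simp) (s, y))).const_mul t).const_sub y)
  have h2 := (hG.differentiable (by simp) (s, y - t * q (s, y))).hasFDerivAt.comp_hasDerivAt s h1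
  refine h2.congr_deriv ?_
  have : ((1 : ℝ), -(t * partialFst q (s, y))) = (1, 0) + (-(t * partialFst q (s, y))) •
      ((0 : ℝ), (1 : ℝ)) := by simp
  rw [this, map_add, map_smul]
  simp only [partialFst, partialSnd, smul_eq_mul]
  ring

theorem hasDerivAt_comp_shear_snd {G q : ℝ × ℝ → ℝ} {t s y : ℝ} (hG : ContDiff ℝ (⊤ : ℕ∞) G)
    (hq : ContDiff ℝ (⊤ : ℕ∞) q) : HasDerivAt (fun r => G (s, r - t * q (s, r)))
      (partialSnd G (s, y - t * q (s, y)) * (1 - t * partialSnd q (s, y))) y := by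
  have h1 := (hasDerivAt_id y).sub ((hasDerivAt_slice_snd
    (hq.differentiable (by simp) (s, y))).const_mul t)
  exact (hasDerivAt_slice_snd (hG.differentiable (by simp) (s, y - t * q (s, y)))).comp y h1

theorem contDiff_inverse_shear {q : ℝ × ℝ → ℝ} {t : ℝ} (hq : ContDiff ℝ (⊤ : ℕ∞) q)
    (hper : ∀ s y, q (s, y + 1) = q (s, y)) (hpos : ∀ s y, 0 < 1 - t * partialSnd q (s, y)) :
    ∃ Y : ℝ × ℝ → ℝ, ContDiff ℝ (⊤ : ℕ∞) Y ∧ (∀ s x, Y (s, x) - t * q (s, Y (s, x)) = x) ∧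
      (∀ s y, Y (s, y - t * q (s, y)) = y) ∧ ∀ s x, Y (s, x + 1) = Y (s, x) + 1 := by
  have hd : ∀ s y, HasDerivAt (fun y => y - t * q (s, y)) (1 - t * partialSnd q (s, y)) y :=
    fun s y => (hasDerivAt_id y).sub ((hasDerivAt_slice_snd
      (hq.differentiable (by simp) (s, y))).const_mul t)
  have hex := fun s => exists_inverse_of_deg_one (hd s) (hpos s)
    (fun y => by rw [hper]; ring)
  choose hinj g hg hg' hgp using hex
  set Φ : ℝ × ℝ → ℝ × ℝ := fun p => (p.1, p.2 - t * q p) with hΦ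
  have hΦs : ContDiff ℝ (⊤ : ℕ∞) Φ := contDiff_fst.prodMk (contDiff_snd.sub (contDiff_const.mul hq))
  have hGs : ContDiff ℝ (⊤ : ℕ∞) fun p : ℝ × ℝ => (p.1, g p.1 p.2) := by
    refine contDiff_of_right_inverse hΦs ?_ (fun ⟨s, x⟩ => ?_) fun ⟨s, y⟩ => ?_
    · rintro ⟨s, y⟩ ⟨s', y'⟩ h
      have h1 : s = s' := (Prod.mk.inj h).1
      subst h1
      have h2 : y = y' := hinj s (Prod.mk.inj h).2
      rw [h2]
    · simp only [hΦ, hg]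
    · set k := 1 - t * partialSnd q (s, y) with hk
      set α := -(t * partialFst q (s, y)) with hα
      have hk0 : k ≠ 0 := (hpos s y).ne'
      let A : ℝ × ℝ →L[ℝ] ℝ × ℝ := (ContinuousLinearMap.fst ℝ ℝ ℝ).prod
        (α • ContinuousLinearMap.fst ℝ ℝ ℝ + k • ContinuousLinearMap.snd ℝ ℝ ℝ)
      let B : ℝ × ℝ →L[ℝ] ℝ × ℝ := (ContinuousLinearMap.fst ℝ ℝ ℝ).prod
        (-(α / k) • ContinuousLinearMap.fst ℝ ℝ ℝ + k⁻¹ • ContinuousLinearMap.snd ℝ ℝ ℝ)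
      refine ⟨ContinuousLinearEquiv.equivOfInverse A B (fun p => ?_) (fun p => ?_), ?_⟩
      · ext
        · simp [A, B]
        · simp [A, B]; field_simp; ring
      · ext
        · simp [A, B]
        · simp [A, B]; field_simp; ring
      · have hqd := (hq.differentiable (by simp) (s, y)).hasFDerivAt
        have h := (hasFDerivAt_fst (𝕜 := ℝ) (p := (s, y))).prodMk
          ((hasFDerivAt_snd (𝕜 := ℝ) (p := (s, y))).sub (hqd.const_mul t))
        refine h.congr_fderiv ?_
        ext
        · simp [A]
        · simp [A, hα, partialFst]
        · simp [A]
        · simp [A, hk, partialSnd]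
  exact ⟨fun p => g p.1 p.2, hGs.snd, fun s x => hg s x, fun s y => hg' s y, fun s x => hgp s x⟩

/-- A potential `h` whose slices are sheared by `(y, p) ↦ (y - t p, p)`: the second derivatives
of the resulting potential `w`. -/
theorem exists_unsheared_potential {h : ℝ × ℝ → ℝ} {t : ℝ} (hh : ContDiff ℝ (⊤ : ℕ∞) h)
    (hper : ∀ s y, h (s, y + 1) = h (s, y))
    (hpos : ∀ s y, 0 < 1 - t * partialSnd (partialSnd h) (s, y)) :
    ∃ w : ℝ × ℝ → ℝ, ContDiff ℝ (⊤ : ℕ∞) w ∧ (∀ s x, w (s, x + 1) = w (s, x)) ∧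
      ∀ s x, ∃ y, x = y - t * partialSnd h (s, y) ∧
        w (s, x) = h (s, y) - t / 2 * partialSnd h (s, y) ^ 2 + t / 2 * s ^ 2 ∧
        partialSnd (partialSnd w) (s, x) * (1 - t * partialSnd (partialSnd h) (s, y)) =
          partialSnd (partialSnd h) (s, y) ∧
        partialFst (partialSnd w) (s, x) * (1 - t * partialSnd (partialSnd h) (s, y)) =
          partialFst (partialSnd h) (s, y) ∧
        partialFst (partialFst w) (s, x) =
          partialFst (partialFst h) (s, y) + t +
            t * partialFst (partialSnd h) (s, y) * partialFst (partialSnd w) (s, x) := by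
  have hq := hh.partialSnd
  have hqper := partialSnd_add_one hh hper
  obtain ⟨Y, hY, hYr, hYl, hYp⟩ := contDiff_inverse_shear hq hqper hpos
  set K : ℝ × ℝ → ℝ := fun p => h p - t / 2 * partialSnd h p ^ 2 + t / 2 * p.1 ^ 2 with hK
  have hKs : ContDiff ℝ (⊤ : ℕ∞) K :=
    (hh.sub (contDiff_const.mul (hq.pow 2))).add (contDiff_const.mul (contDiff_fst.pow 2))
  set w : ℝ × ℝ → ℝ := fun p => K (p.1, Y p) with hw
  have hws : ContDiff ℝ (⊤ : ℕ∞) w := hKs.comp (contDiff_fst.prodMk hY)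
  have hwK : ∀ s y, w (s, y - t * partialSnd h (s, y)) = K (s, y) := fun s y => by
    simp only [hw, hYl]
  have hd0 : Differentiable ℝ h := hh.differentiable (by simp)
  have hd1 : Differentiable ℝ (partialFst h) := hh.partialFst.differentiable (by simp)
  have hd2 : Differentiable ℝ (partialSnd h) := hq.differentiable (by simp)
  have w2 : ∀ s y, partialSnd w (s, y - t * partialSnd h (s, y)) = partialSnd h (s, y) := by
    intro s y
    have e1 := hasDerivAt_comp_shear_snd (t := t) (s := s) (y := y) hws hq
    simp only [hwK] at e1
    have e2 : HasDerivAt (fun r => K (s, r)) _ y := ((hasDerivAt_slice_snd (hd0 (s, y))).sub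
      (((hasDerivAt_slice_snd (hd2 (s, y))).pow 2).const_mul (t / 2))).add_const (t / 2 * s ^ 2)
    have e3 := e1.unique e2
    refine mul_right_cancel₀ (hpos s y).ne' (e3.trans ?_)
    simp
    ring
  have w1 : ∀ s y, partialFst w (s, y - t * partialSnd h (s, y)) = partialFst h (s, y) + t * s := by
    intro s y
    have e1 := hasDerivAt_comp_shear_fst (t := t) (s := s) (y := y) hws hq
    simp only [hwK, w2] at e1
    have e2 : HasDerivAt (fun r => K (r, y)) _ s := ((hasDerivAt_slice_fst (hd0 (s, y))).sub
      (((hasDerivAt_slice_fst (hd2 (s, y))).pow 2).const_mul (t / 2))).add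
        ((hasDerivAt_pow 2 s).const_mul (t / 2))
    have e3 := e1.unique e2
    rw [sub_eq_iff_eq_add] at e3
    rw [e3]
    simp
    ring
  refine ⟨w, hws, fun s x => ?_, fun s x => ⟨Y (s, x), (hYr s x).symm, rfl, ?_⟩⟩
  · simp only [hw, hYp, hK, hper, hqper]
  obtain ⟨y, hy⟩ : ∃ y, Y (s, x) = y := ⟨_, rfl⟩
  have hx : x = y - t * partialSnd h (s, y) := by rw [← hy, hYr]
  rw [hy, hx]
  have e22 := hasDerivAt_comp_shear_snd (t := t) (s := s) (y := y) hws.partialSnd hq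
  have e12 := hasDerivAt_comp_shear_snd (t := t) (s := s) (y := y) hws.partialFst hq
  have e11 := hasDerivAt_comp_shear_fst (t := t) (s := s) (y := y) hws.partialFst hq
  simp only [w2] at e22
  simp only [w1] at e12 e11
  have f22 := e22.unique (hasDerivAt_slice_snd (hd2 (s, y)))
  have f12 := e12.unique ((hasDerivAt_slice_snd (hd1 (s, y))).add_const (t * s))
  have f11 := e11.unique ((hasDerivAt_slice_fst (hd1 (s, y))).add ((hasDerivAt_id s).const_mul t))
  rw [← partialFst_partialSnd hws] at f12 f11
  rw [← partialFst_partialSnd hh] at f12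
  exact ⟨f22, f12, by rw [sub_eq_iff_eq_add] at f11; rw [f11]; ring⟩

theorem partialFst_const_mul {f : ℝ × ℝ → ℝ} (hf : ContDiff ℝ (⊤ : ℕ∞) f) (a : ℝ) :
    partialFst (fun p => a * f p) = fun p => a * partialFst f p := by
  ext p
  rw [partialFst, fderiv_const_mul (hf.differentiable (by simp) p)]
  rfl

theorem partialSnd_const_mul {f : ℝ × ℝ → ℝ} (hf : ContDiff ℝ (⊤ : ℕ∞) f) (a : ℝ) :
    partialSnd (fun p => a * f p) = fun p => a * partialSnd f p := by
  ext p
  rw [partialSnd, fderiv_const_mul (hf.differentiable (by simp) p)]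
  rfl

theorem partialFst_const_sub (f : ℝ × ℝ → ℝ) (a : ℝ) :
    partialFst (fun p => a - f p) = fun p => -partialFst f p := by
  ext p
  rw [partialFst, fderiv_const_sub]
  rfl

theorem partialSnd_const_sub (f : ℝ × ℝ → ℝ) (a : ℝ) :
    partialSnd (fun p => a - f p) = fun p => -partialSnd f p := by
  ext p
  rw [partialSnd, fderiv_const_sub]
  rfl

theorem partialFst_neg (f : ℝ × ℝ → ℝ) :
    partialFst (fun p => -f p) = fun p => -partialFst f p := by
  simpa using partialFst_const_sub f 0

theorem partialSnd_neg (f : ℝ × ℝ → ℝ) :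
    partialSnd (fun p => -f p) = fun p => -partialSnd f p := by
  simpa using partialSnd_const_sub f 0

theorem partialFst_congr {f g : ℝ × ℝ → ℝ} {p : ℝ × ℝ} (h : f =ᶠ[nhds p] g) :
    partialFst f =ᶠ[nhds p] partialFst g := by
  filter_upwards [h.fderiv (𝕜 := ℝ)] with q hq
  rw [partialFst, hq, partialFst]

theorem partialSnd_congr {f g : ℝ × ℝ → ℝ} {p : ℝ × ℝ} (h : f =ᶠ[nhds p] g) :
    partialSnd f =ᶠ[nhds p] partialSnd g := by
  filter_upwards [h.fderiv (𝕜 := ℝ)] with q hq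
  rw [partialSnd, hq, partialSnd]

theorem partialSnd_eq_deriv {f : ℝ × ℝ → ℝ} (hf : ContDiff ℝ (⊤ : ℕ∞) f) (s y : ℝ) :
    partialSnd f (s, y) = deriv (fun r => f (s, r)) y :=
  (hasDerivAt_slice_snd (hf.differentiable (by simp) _)).deriv.symm

theorem partialSnd_partialSnd_eq_deriv {f : ℝ × ℝ → ℝ} (hf : ContDiff ℝ (⊤ : ℕ∞) f) (s y : ℝ) :
    partialSnd (partialSnd f) (s, y) = deriv (deriv fun r => f (s, r)) y := by
  rw [partialSnd_eq_deriv hf.partialSnd]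
  congr 1
  ext r
  exact partialSnd_eq_deriv hf s r

/-- Second derivatives along the second variable of a solution of a constant coefficient equation
solve the same equation. -/
theorem partialSnd_partialSnd_strip_eq {μ : ℝ} {S : Set ℝ} {h : ℝ × ℝ → ℝ}
    (hh : ContDiff ℝ (⊤ : ℕ∞) h)
    (heq : ∀ s ∈ S, ∀ y, partialFst (partialFst h) (s, y) +
        μ ^ 2 * partialSnd (partialSnd h) (s, y) = 0) :
    ∀ s ∈ S, ∀ y, partialFst (partialFst (partialSnd (partialSnd h))) (s, y) +
        μ ^ 2 * partialSnd (partialSnd (partialSnd (partialSnd h))) (s, y) = 0 := by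
  intro s hs y
  set F : ℝ × ℝ → ℝ := fun p => partialFst (partialFst h) p +
    μ ^ 2 * partialSnd (partialSnd h) p with hF
  have c1 := hh.partialFst.partialFst
  have c2 : ContDiff ℝ (⊤ : ℕ∞) fun p => μ ^ 2 * partialSnd (partialSnd h) p :=
    contDiff_const.mul hh.partialSnd.partialSnd
  have hFs : ContDiff ℝ (⊤ : ℕ∞) F := c1.add c2
  have h1 : partialSnd (partialSnd F) (s, y) = 0 := by
    rw [partialSnd_partialSnd_eq_deriv hFs]
    have : (fun r => F (s, r)) = fun _ => 0 := funext fun r => heq s hs r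
    simp [this]
  have key : ∀ g : ℝ × ℝ → ℝ, ContDiff ℝ (⊤ : ℕ∞) g → partialFst (partialSnd (partialSnd g)) =
      partialSnd (partialSnd (partialFst g)) := fun g hg => by
    rw [partialFst_partialSnd hg.partialSnd, partialFst_partialSnd hg]
  rw [key h hh, key _ hh.partialFst, ← h1]
  have h2 : partialSnd (partialSnd F) = fun p => partialSnd (partialSnd (partialFst
      (partialFst h))) p + μ ^ 2 * partialSnd (partialSnd (partialSnd (partialSnd h))) p := by
    rw [hF, partialSnd_add c1 c2, partialSnd_const_mul hh.partialSnd.partialSnd,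
      partialSnd_add c1.partialSnd (contDiff_const.mul hh.partialSnd.partialSnd.partialSnd),
      partialSnd_const_mul hh.partialSnd.partialSnd.partialSnd]
  rw [h2]

theorem exists_cutoff_pos {T : ℝ} {m : ℝ × ℝ → ℝ} (hm : Continuous m)
    (hper : ∀ s y, m (s, y + 1) = m (s, y)) (hpos : ∀ s ∈ Set.Icc 0 T, ∀ y, 0 < m (s, y)) :
    ∃ χ : ℝ → ℝ, ContDiff ℝ (⊤ : ℕ∞) χ ∧ (∀ s, 0 ≤ χ s) ∧ (∀ s, χ s ≤ 1) ∧
      (∀ s ∈ Set.Icc 0 T, ∀ᶠ r in nhds s, χ r = 1) ∧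
      ∀ s, χ s ≠ 0 → ∀ y, 0 < m (s, y) := by
  obtain ⟨U, V, hU, -, hTU, hV, hUV⟩ := generalized_tube_lemma
    (isCompact_Icc (a := (0 : ℝ)) (b := T)) (isCompact_Icc (a := (0 : ℝ)) (b := 1))
    (n := {p | 0 < m p}) (isOpen_lt continuous_const hm) (fun p hp => hpos p.1 hp.1 p.2)
  obtain ⟨χ, h1, h2, h3⟩ := exists_contMDiffMap_one_nhds_of_subset_interior (n := (⊤ : ℕ∞))
    (modelWithCornersSelf ℝ ℝ) isClosed_Icc (hU.interior_eq.symm ▸ hTU)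
  refine ⟨χ, χ.contMDiff.contDiff, fun s => (h3 s).1, fun s => (h3 s).2, fun s hs =>
    h1.filter_mono (nhds_le_nhdsSet hs), fun s hs y => ?_⟩
  have hsU : s ∈ U := by
    by_contra hc
    exact hs (h2 s hc)
  obtain ⟨y', hy', h⟩ := (show Function.Periodic (fun y => m (s, y)) 1 from
    fun y => hper s y).exists_mem_Ico₀ zero_lt_one y
  change m (s, y) = m (s, y') at h
  rw [h]
  exact hUV (show (s, y') ∈ U ×ˢ V from ⟨hsU, hV ⟨hy'.1, hy'.2.le⟩⟩)

/-- The special Lagrangian equation `arctan λ₁ + arctan λ₂ = arctan t` with periodic Dirichlet data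
on the strip `[0, T] × ℝ`. -/
theorem exists_special_lagrangian_strip {t T : ℝ} (hT : 0 < T) {ψ₀ ψ₁ : ℝ → ℝ}
    (h₀ : ContDiff ℝ (⊤ : ℕ∞) ψ₀) (h₁ : ContDiff ℝ (⊤ : ℕ∞) ψ₁)
    (hp₀ : Function.Periodic ψ₀ 1) (hp₁ : Function.Periodic ψ₁ 1)
    (hpos₀ : ∀ x, 0 < 1 + t * deriv (deriv ψ₀) x) (hpos₁ : ∀ x, 0 < 1 + t * deriv (deriv ψ₁) x) :
    ∃ w : ℝ × ℝ → ℝ, ContDiff ℝ (⊤ : ℕ∞) w ∧ (∀ s x, w (s, x + 1) = w (s, x)) ∧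
      (∀ x, w (0, x) = ψ₀ x) ∧ (∀ x, w (T, x) = ψ₁ x) ∧
      ∀ s ∈ Set.Icc 0 T, ∀ x, 0 < 1 + t * partialSnd (partialSnd w) (s, x) ∧
        partialFst (partialFst w) (s, x) * (1 + t * partialSnd (partialSnd w) (s, x)) =
          t * (1 + partialFst (partialSnd w) (s, x) ^ 2) - partialSnd (partialSnd w) (s, x) := by
  obtain ⟨φ₀, f₀, g₀, k₀, l₀⟩ := exists_sheared_potential h₀ hp₀ hpos₀
  obtain ⟨φ₁, f₁, g₁, k₁, l₁⟩ := exists_sheared_potential h₁ hp₁ hpos₁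
  have hμ : 0 < √(1 + t ^ 2) := by positivity
  have hμ2 : √(1 + t ^ 2) ^ 2 = 1 + t ^ 2 := Real.sq_sqrt (by positivity)
  obtain ⟨h, hh, hper, hb0, hbT, heq⟩ := exists_strip_dirichlet hμ hT f₀
    (f₁.sub contDiff_const) g₀ (φ₁ := fun y => φ₁ y - t / 2 * T ^ 2) (fun y => by simp only [g₁ y])
  have hq := hh.partialSnd.partialSnd
  set m : ℝ × ℝ → ℝ := fun p => 1 - t * partialSnd (partialSnd h) p with hm
  have hms : ContDiff ℝ (⊤ : ℕ∞) m := contDiff_const.sub (contDiff_const.mul hq)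
  have hmper : ∀ s y, m (s, y + 1) = m (s, y) := fun s y => by
    simp only [hm]
    rw [partialSnd_add_one hh.partialSnd (partialSnd_add_one hh hper)]
  have hmF : partialFst (partialFst m) =
      fun p => -(t * partialFst (partialFst (partialSnd (partialSnd h))) p) := by
    rw [hm, partialFst_const_sub, partialFst_const_mul hq, partialFst_neg,
      partialFst_const_mul hq.partialFst]
  have hmS : partialSnd (partialSnd m) =
      fun p => -(t * partialSnd (partialSnd (partialSnd (partialSnd h))) p) := by
    rw [hm, partialSnd_const_sub, partialSnd_const_mul hq, partialSnd_neg,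
      partialSnd_const_mul hq.partialSnd]
  have hmpos : ∀ s ∈ Set.Icc 0 T, ∀ y, 0 < m (s, y) := by
    refine pos_of_strip_dirichlet (μ := √(1 + t ^ 2)) hT hms hmper (fun y => ?_) (fun y => ?_)
      fun s hs y => ?_
    · simp only [hm, partialSnd_partialSnd_eq_deriv hh, hb0]
      exact k₀ y
    · simp only [hm, partialSnd_partialSnd_eq_deriv hh, hbT, deriv_sub_const_fun]
      exact k₁ y
    · rw [hmF, hmS]
      linear_combination (-t) * partialSnd_partialSnd_strip_eq hh heq s hs y
  obtain ⟨χ, hχ, hχ0, hχ1, hχT, hχm⟩ := exists_cutoff_pos hms.continuous hmper hmpos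
  set H : ℝ × ℝ → ℝ := fun p => χ p.1 * h p with hH
  have hHs : ContDiff ℝ (⊤ : ℕ∞) H := (hχ.comp contDiff_fst).mul hh
  have hHyy : ∀ s y, partialSnd (partialSnd H) (s, y) = χ s * partialSnd (partialSnd h) (s, y) := by
    intro s y
    rw [partialSnd_partialSnd_eq_deriv hHs, partialSnd_partialSnd_eq_deriv hh]
    simp [hH]
  have hHh : ∀ s ∈ Set.Icc 0 T, ∀ y, H =ᶠ[nhds (s, y)] h := fun s hs y => by
    have := (continuous_fst.tendsto (s, y)).eventually (hχT s hs)
    filter_upwards [this] with p hp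
    simp only [hH, hp, one_mul]
  have hHpos : ∀ s y, 0 < 1 - t * partialSnd (partialSnd H) (s, y) := fun s y => by
    rw [hHyy]
    rcases eq_or_ne (χ s) 0 with h0 | h0
    · simp [h0]
    · have e1 := hχm s h0 y
      have e2 := (hχ0 s).lt_of_ne h0.symm
      have : 1 - t * (χ s * partialSnd (partialSnd h) (s, y)) =
        (1 - χ s) + χ s * m (s, y) := by simp only [hm]; ring
      rw [this]
      have := hχ1 s
      have := mul_pos e2 e1
      linarith
  obtain ⟨w, hw, hwper, hwx⟩ := exists_unsheared_potential hHs
    (fun s y => by simp only [hH, hper]) hHpos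
  have hTm : T ∈ Set.Icc 0 T := ⟨hT.le, le_rfl⟩
  have h0m : (0 : ℝ) ∈ Set.Icc 0 T := ⟨le_rfl, hT.le⟩
  refine ⟨w, hw, hwper, fun x => ?_, fun x => ?_, fun s hs x => ?_⟩
  · obtain ⟨y, hxy, hwe, -⟩ := hwx 0 x
    have hy : partialSnd H (0, y) = deriv φ₀ y := by
      rw [(partialSnd_congr (hHh 0 h0m y)).eq_of_nhds, partialSnd_eq_deriv hh]
      simp only [hb0]
    rw [hwe, hxy, hy, (hHh 0 h0m y).eq_of_nhds, hb0, l₀]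
    ring
  · obtain ⟨y, hxy, hwe, -⟩ := hwx T x
    have hy : partialSnd H (T, y) = deriv φ₁ y := by
      rw [(partialSnd_congr (hHh T hTm y)).eq_of_nhds, partialSnd_eq_deriv hh]
      simp only [hbT, deriv_sub_const_fun]
    rw [hwe, hxy, hy, (hHh T hTm y).eq_of_nhds, hbT, l₁]
    ring
  · obtain ⟨y, -, -, exx, esx, ess⟩ := hwx s x
    have hk := hHpos s y
    have hpde : partialFst (partialFst H) (s, y) +
        (1 + t ^ 2) * partialSnd (partialSnd H) (s, y) = 0 := by
      rw [(partialFst_congr (partialFst_congr (hHh s hs y))).eq_of_nhds,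
        (partialSnd_congr (partialSnd_congr (hHh s hs y))).eq_of_nhds, ← hμ2]
      exact heq s hs y
    generalize partialSnd (partialSnd H) (s, y) = b at *
    generalize partialFst (partialFst H) (s, y) = a at *
    generalize partialFst (partialSnd H) (s, y) = c at *
    have e1 : (1 + t * partialSnd (partialSnd w) (s, x)) * (1 - t * b) = 1 := by
      linear_combination t * exx
    have e2 : 0 < 1 + t * partialSnd (partialSnd w) (s, x) :=
      pos_of_mul_pos_left (by rw [e1]; exact one_pos) hk.le
    refine ⟨e2, mul_right_cancel₀ hk.ne' ?_⟩
    rw [ess]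
    generalize partialSnd (partialSnd w) (s, x) = X at *
    generalize partialFst (partialSnd w) (s, x) = Y at *
    linear_combination (a + t + t * c * Y) * e1 + hpde - t * Y * esx + exx

theorem exists_linear_increment {n : ℕ} {u : (Fin n → ℝ) → ℝ} (hu : Differentiable ℝ u)
    (hper : ∀ (x : Fin n → ℝ) (k : Fin n → ℤ),
      fderiv ℝ u (x + fun j => (k j : ℝ)) = fderiv ℝ u x) :
    ∃ a : Fin n → ℝ, ∀ (x : Fin n → ℝ) (k : Fin n → ℤ),
      u (x + fun j => (k j : ℝ)) = u x + ∑ j, a j * k j := by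
  have hconst : ∀ (x : Fin n → ℝ) (k : Fin n → ℤ),
      u (x + fun j => (k j : ℝ)) - u x = u (fun j => (k j : ℝ)) - u 0 := fun x k => by
    have hk : Differentiable ℝ fun x => u (x + fun j => (k j : ℝ)) :=
      hu.comp (differentiable_id.add_const _)
    have h := is_const_of_fderiv_eq_zero (𝕜 := ℝ) (hk.sub hu) (fun x => by
      rw [fderiv_sub (hk x) (hu x), fderiv_comp_add_right, hper, sub_self]) x 0
    simpa using h
  let c : (Fin n → ℤ) →+ ℝ := AddMonoidHom.mk' (fun k => u (fun j => (k j : ℝ)) - u 0)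
    fun k l => by
      have h := hconst (fun j => (k j : ℝ)) l
      have e : (fun j => ((k + l) j : ℝ)) = (fun j => (k j : ℝ)) + fun j => (l j : ℝ) := by
        ext j; simp
      rw [e]
      linarith
  refine ⟨fun j => c.toIntLinearMap fun i => if j = i then 1 else 0, fun x k => ?_⟩
  have h := LinearMap.pi_apply_eq_sum_univ c.toIntLinearMap k
  have h2 : c.toIntLinearMap k = u (fun j => (k j : ℝ)) - u 0 := rfl
  rw [h2] at h
  rw [← sub_eq_iff_eq_add', hconst, h]
  exact Finset.sum_congr rfl fun j _ => by rw [zsmul_eq_mul, mul_comm]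

theorem exists_forall_le_of_periodic {n : ℕ} {ψ : (Fin n → ℝ) → ℝ} (hψ : Continuous ψ)
    (hper : ∀ (x : Fin n → ℝ) (k : Fin n → ℤ), ψ (x + fun j => (k j : ℝ)) = ψ x) :
    ∃ x₀, ∀ x, ψ x ≤ ψ x₀ := by
  obtain ⟨x₀, -, hmax⟩ := (isCompact_Icc (a := (0 : Fin n → ℝ)) (b := 1)).exists_isMaxOn
    (Set.nonempty_Icc.2 zero_le_one) hψ.continuousOn
  refine ⟨x₀, fun x => ?_⟩
  have e : x = (fun j => Int.fract (x j)) + fun j => ((⌊x j⌋ : ℤ) : ℝ) := by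
    ext j
    simp
  rw [e, hper]
  exact hmax ⟨fun j => Int.fract_nonneg _, fun j => (Int.fract_lt_one _).le⟩

theorem dotProduct_hess_mulVec {m : ℕ} {u : (Fin m → ℝ) → ℝ} (hu : ContDiff ℝ (⊤ : ℕ∞) u)
    (x v : Fin m → ℝ) :
    v ⬝ᵥ (hess u x).mulVec v = fderiv ℝ (fun y => fderiv ℝ u y v) x v := by
  have hd : Differentiable ℝ (fderiv ℝ u) :=
    (hu.fderiv_right (m := (⊤ : ℕ∞)) (by simp)).differentiable (by simp)
  have hv : v = ∑ i, v i • (Pi.single i (1 : ℝ) : Fin m → ℝ) := by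
    ext j
    simp [Finset.sum_apply, Pi.single_apply]
  have hF : ∀ w z : Fin m → ℝ, fderiv ℝ (fun y => fderiv ℝ u y w) x z =
      fderiv ℝ (fderiv ℝ u) x z w := fun w z => by
    rw [fderiv_clm_apply (hd x) (by fun_prop)]
    simp
  rw [hF]
  conv_rhs => rw [hv]
  simp only [map_sum, map_smul, sum_apply, smul_apply,
    smul_eq_mul, dotProduct, Matrix.mulVec, hess, Matrix.of_apply, hF, Finset.mul_sum]
  rw [Finset.sum_comm]
  exact Finset.sum_congr rfl fun i _ => Finset.sum_congr rfl fun j _ => by ring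

/-- The graph of a potential with periodic gradient has nonpositive phase somewhere. -/
theorem exists_lagPhase_nonpos {n : ℕ} {u : (Fin n → ℝ) → ℝ} (hu : ContDiff ℝ (⊤ : ℕ∞) u)
    (hper : ∀ (x : Fin n → ℝ) (k : Fin n → ℤ),
      fderiv ℝ u (x + fun j => (k j : ℝ)) = fderiv ℝ u x) :
    ∃ x, lagPhase (hess u x) ≤ 0 := by
  obtain ⟨a, ha⟩ := exists_linear_increment (hu.differentiable (by simp)) hper
  obtain ⟨x, hx⟩ := exists_forall_le_of_periodic (ψ := fun x => u x - ∑ j, a j * x j)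
    (by have := hu.continuous; fun_prop) fun x k => by
      simp only [ha, Pi.add_apply, mul_add, Finset.sum_add_distrib]
      ring
  refine ⟨x, ?_⟩
  unfold lagPhase
  split_ifs with hM
  swap
  · exact le_rfl
  refine Finset.sum_nonpos fun j _ => Real.arctan_le_zero.2 ?_
  set v : Fin n → ℝ := ⇑(hM.eigenvectorBasis j) with hv
  have hv0 : 0 < v ⬝ᵥ v := by
    have h : v ≠ 0 := fun h0 => (hM.eigenvectorBasis.toBasis.ne_zero j) (by
      ext i
      simpa using congrFun h0 i)
    exact lt_of_le_of_ne (Finset.sum_nonneg fun i _ => mul_self_nonneg _)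
      (Ne.symm (by rwa [Ne, dotProduct_self_eq_zero]))
  have hquad : v ⬝ᵥ (hess u x).mulVec v = hM.eigenvalues j * (v ⬝ᵥ v) := by
    rw [hv, hM.mulVec_eigenvectorBasis j, dotProduct_smul, smul_eq_mul]
  rw [dotProduct_hess_mulVec hu] at hquad
  have hline : ∀ r : ℝ, HasDerivAt (fun r : ℝ => x + r • v) v r := fun r => by
    simpa using ((hasDerivAt_id r).smul_const v).const_add x
  set g : ℝ → ℝ := fun r => ∑ j, a j * (x + r • v) j - u (x + r • v) with hg
  have hlin : ∀ r, HasDerivAt (fun r : ℝ => ∑ j, a j * (x + r • v) j) (∑ j, a j * v j) r :=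
    fun r => HasDerivAt.fun_sum fun j _ =>
      ((hasDerivAt_pi.1 (hline r) j).const_mul (a j))
  have hg1 : ∀ r, HasDerivAt g (∑ j, a j * v j - fderiv ℝ u (x + r • v) v) r := fun r =>
    (hlin r).sub ((hu.differentiable (by simp) _).hasFDerivAt.comp_hasDerivAt r (hline r))
  have hd : Differentiable ℝ fun y => fderiv ℝ u y v :=
    ((hu.fderiv_right (m := (⊤ : ℕ∞)) (by simp)).clm_apply contDiff_const).differentiable (by simp)
  have hg2 : deriv (deriv g) 0 = -fderiv ℝ (fun y => fderiv ℝ u y v) x v := by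
    rw [show deriv g = _ from funext fun r => (hg1 r).deriv]
    have h := ((hd _).hasFDerivAt.comp_hasDerivAt 0 (hline 0)).const_sub (∑ j, a j * v j)
    have h' := h.deriv
    simpa using h'
  have hmin : IsLocalMin g 0 := Filter.Eventually.of_forall fun r => by
    have := hx (x + r • v)
    simp only [hg, zero_smul, add_zero]
    linarith
  have hnn := deriv_deriv_nonneg_of_isLocalMin (hg1 0).continuousAt hmin
  rw [hg2, hquad] at hnn
  by_contra! hc
  have := mul_pos hc hv0
  linarith

theorem fderiv_comp_plane {W : ℝ × ℝ → ℝ} (hW : Differentiable ℝ W) (p e : Fin 2 → ℝ) :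
    fderiv ℝ (fun p : Fin 2 → ℝ => W (p 0, p 1)) p e = fderiv ℝ W (p 0, p 1) (e 0, e 1) := by
  have h1 : HasFDerivAt (fun p : Fin 2 → ℝ => (p 0, p 1))
      ((ContinuousLinearMap.proj (R := ℝ) (φ := fun _ : Fin 2 => ℝ) 0).prod
        (ContinuousLinearMap.proj 1)) p :=
    (hasFDerivAt_apply 0 p).prodMk (hasFDerivAt_apply 1 p)
  have h2 := (hW (p 0, p 1)).hasFDerivAt.comp p h1
  exact congrArg (fun L : (Fin 2 → ℝ) →L[ℝ] ℝ => L e) h2.fderiv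

theorem hess_comp_plane {W : ℝ × ℝ → ℝ} (hW : ContDiff ℝ (⊤ : ℕ∞) W) (p : Fin 2 → ℝ) :
    hess (fun p : Fin 2 → ℝ => W (p 0, p 1)) p =
      !![partialFst (partialFst W) (p 0, p 1), partialFst (partialSnd W) (p 0, p 1);
        partialSnd (partialFst W) (p 0, p 1), partialSnd (partialSnd W) (p 0, p 1)] := by
  have h0 : (fun y : Fin 2 → ℝ => fderiv ℝ (fun p : Fin 2 → ℝ => W (p 0, p 1)) y
      (Pi.single 0 1)) = fun y => partialFst W (y 0, y 1) := funext fun y => by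
    rw [fderiv_comp_plane (hW.differentiable (by simp))]
    simp [partialFst]
  have h1 : (fun y : Fin 2 → ℝ => fderiv ℝ (fun p : Fin 2 → ℝ => W (p 0, p 1)) y
      (Pi.single 1 1)) = fun y => partialSnd W (y 0, y 1) := funext fun y => by
    rw [fderiv_comp_plane (hW.differentiable (by simp))]
    simp [partialSnd]
  have d0 := fderiv_comp_plane (hW.partialFst.differentiable (by simp)) p
  have d1 := fderiv_comp_plane (hW.partialSnd.differentiable (by simp)) p
  ext i j
  fin_cases i <;> fin_cases j
  · simp [hess, h0, d0]
    rfl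
  · simp [hess, h1, d1]
    rfl
  · simp [hess, h0, d0]
    rfl
  · simp [hess, h1, d1]
    rfl

theorem deriv_deriv_comp_line {u : (Fin 1 → ℝ) → ℝ} (hu : ContDiff ℝ (⊤ : ℕ∞) u) (r : ℝ) :
    deriv (deriv fun r => u fun _ => r) r = hess u (fun _ => r) 0 0 := by
  have e : (Pi.single 0 1 : Fin 1 → ℝ) = fun _ => 1 := by
    ext i
    simp [Subsingleton.elim i 0]
  have hline : ∀ r : ℝ, HasDerivAt (fun (r : ℝ) (_ : Fin 1) => r) (fun _ => 1) r := fun r =>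
    hasDerivAt_pi.2 fun _ => hasDerivAt_id r
  have h1 : ∀ r : ℝ, HasDerivAt (fun r => u fun _ => r) (fderiv ℝ u (fun _ => r) fun _ => 1) r :=
    fun r => (hu.differentiable (by simp) _).hasFDerivAt.comp_hasDerivAt r (hline r)
  have hd : Differentiable ℝ fun y => fderiv ℝ u y fun _ => 1 :=
    ((hu.fderiv_right (m := (⊤ : ℕ∞)) (by simp)).clm_apply contDiff_const).differentiable (by simp)
  rw [show deriv (fun r => u fun _ => r) = _ from funext fun r => (h1 r).deriv]
  have h2 := ((hd fun _ => r).hasFDerivAt.comp_hasDerivAt r (hline r)).deriv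
  simp only [hess, Matrix.of_apply, e]
  exact h2

theorem one_add_tan_mul_pos {Θ b : ℝ} (h0 : 0 ≤ Θ) (h1 : Θ < Real.pi / 2)
    (h : Θ - Real.pi / 2 < Real.arctan b) : 0 < 1 + Real.tan Θ * b := by
  rcases h0.eq_or_lt with rfl | h0
  · simp
  have ht := Real.tan_pos_of_pos_of_lt_pi_div_two h0 h1
  have h2 := Real.tan_lt_tan_of_lt_of_lt_pi_div_two (by linarith)
    (Real.arctan_lt_pi_div_two b) h
  rw [Real.tan_arctan, ← neg_sub, Real.tan_neg, Real.tan_pi_div_two_sub] at h2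
  have h3 := mul_lt_mul_of_pos_left h2 ht
  rw [mul_neg, mul_inv_cancel₀ ht.ne'] at h3
  linarith

/-- The Dirichlet problem on the cylinder over the circle. -/
theorem exists_special_lagrangian_cylinder {u₀ u₁ : (Fin 1 → ℝ) → ℝ}
    (hu₀ : ContDiff ℝ (⊤ : ℕ∞) u₀) (hu₁ : ContDiff ℝ (⊤ : ℕ∞) u₁)
    (hper₀ : ∀ (x : Fin 1 → ℝ) (k : Fin 1 → ℤ),
      fderiv ℝ u₀ (x + fun j => (k j : ℝ)) = fderiv ℝ u₀ x)
    (hdiff : ∀ (x : Fin 1 → ℝ) (k : Fin 1 → ℤ),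
      u₁ (x + fun j => (k j : ℝ)) - u₀ (x + fun j => (k j : ℝ)) = u₁ x - u₀ x)
    {Θ : ℝ} (hΘ₁ : 0 ≤ Θ) (hΘ₂ : Θ < Real.pi / 2)
    (hphase₀ : ∀ x, Θ - Real.pi / 2 < lagPhase (hess u₀ x))
    (hphase₁ : ∀ x, Θ - Real.pi / 2 < lagPhase (hess u₁ x)) {T : ℝ} (hT : 0 < T) :
    ∃ v : (Fin (1 + 1) → ℝ) → ℝ, ContDiff ℝ (⊤ : ℕ∞) v ∧
      (∀ (s : ℝ) (x : Fin 1 → ℝ) (k : Fin 1 → ℤ),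
        v (Fin.cons s (x + fun j => (k j : ℝ))) = v (Fin.cons s x)) ∧
      (∀ x : Fin 1 → ℝ, v (Fin.cons 0 x) = 0) ∧
      (∀ x : Fin 1 → ℝ, v (Fin.cons T x) = 0) ∧
      (∀ s ∈ Set.Icc (0 : ℝ) T, ∀ x : Fin 1 → ℝ,
        lagPhase (hess (fun p => (1 - p 0 / T) * u₀ (Fin.tail p)
            + (p 0 / T) * u₁ (Fin.tail p) + v p) (Fin.cons s x)) = Θ) := by
  obtain ⟨a, ha₀⟩ := exists_linear_increment (hu₀.differentiable (by simp)) hper₀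
  have ha₁ : ∀ (x : Fin 1 → ℝ) (k : Fin 1 → ℤ),
      u₁ (x + fun j => (k j : ℝ)) = u₁ x + ∑ j, a j * k j := fun x k => by
    linarith [ha₀ x k, hdiff x k]
  have hψs : ∀ u : (Fin 1 → ℝ) → ℝ, ContDiff ℝ (⊤ : ℕ∞) u →
      ContDiff ℝ (⊤ : ℕ∞) fun r : ℝ => u (fun _ => r) - a 0 * r := fun u hu =>
    (hu.comp (contDiff_pi.2 fun _ => contDiff_id)).sub (contDiff_const.mul contDiff_id)
  have hψp : ∀ u : (Fin 1 → ℝ) → ℝ, (∀ (x : Fin 1 → ℝ) (k : Fin 1 → ℤ),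
      u (x + fun j => (k j : ℝ)) = u x + ∑ j, a j * k j) →
      Function.Periodic (fun r : ℝ => u (fun _ => r) - a 0 * r) 1 := fun u hu r => by
    have h := hu (fun _ => r) fun _ => 1
    have e : (fun _ : Fin 1 => r + 1) = (fun _ => r) + fun _ => ((1 : ℤ) : ℝ) := by
      ext
      simp
    simp only [e, h]
    simp
    ring
  have hψpos : ∀ u : (Fin 1 → ℝ) → ℝ, ContDiff ℝ (⊤ : ℕ∞) u →
      (∀ x, Θ - Real.pi / 2 < lagPhase (hess u x)) →
      ∀ x, 0 < 1 + Real.tan Θ * deriv (deriv fun r : ℝ => u (fun _ => r) - a 0 * r) x := by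
    intro u hu hp x
    have hU : ContDiff ℝ (⊤ : ℕ∞) fun r : ℝ => u fun _ => r :=
      hu.comp (contDiff_pi.2 fun _ => contDiff_id)
    have h1 : deriv (fun r : ℝ => u (fun _ => r) - a 0 * r) =
        fun r => deriv (fun r : ℝ => u fun _ => r) r - a 0 := funext fun r => by
      rw [deriv_fun_sub (hU.differentiable (by simp) r) (by fun_prop)]
      simp
    rw [h1, deriv_sub_const_fun, deriv_deriv_comp_line hu]
    refine one_add_tan_mul_pos hΘ₁ hΘ₂ ?_
    rw [← lagPhase_fin_one]
    exact hp _
  obtain ⟨w, hw, hwper, hw0, hwT, hweq⟩ := exists_special_lagrangian_strip hT (hψs u₀ hu₀)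
    (hψs u₁ hu₁) (hψp u₀ ha₀) (hψp u₁ ha₁) (hψpos u₀ hu₀ hphase₀) (hψpos u₁ hu₁ hphase₁)
  set W : ℝ × ℝ → ℝ := fun q => w q + a 0 * q.2 with hW
  have hWs : ContDiff ℝ (⊤ : ℕ∞) W := hw.add (contDiff_const.mul contDiff_snd)
  refine ⟨fun p => W (p 0, p 1) - ((1 - p 0 / T) * u₀ (Fin.tail p) + p 0 / T * u₁ (Fin.tail p)),
    ?_, fun s x k => ?_, fun x => ?_, fun x => ?_, fun s hs x => ?_⟩
  · have c : ∀ i : Fin (1 + 1), ContDiff ℝ (⊤ : ℕ∞) fun p : Fin (1 + 1) → ℝ => p i :=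
      fun i => contDiff_apply ℝ ℝ i
    have ct : ContDiff ℝ (⊤ : ℕ∞) fun p : Fin (1 + 1) → ℝ => (Fin.tail p : Fin 1 → ℝ) :=
      contDiff_pi.2 fun i => c i.succ
    exact (hWs.comp ((c 0).prodMk (c 1))).sub (((contDiff_const.sub ((c 0).div_const T)).mul
      (hu₀.comp ct)).add (((c 0).div_const T).mul (hu₁.comp ct)))
  · have h1 : w (s, x 0 + k 0) = w (s, x 0) := by
      have := (show Function.Periodic (fun y => w (s, y)) 1 from
        fun y => hwper s y).int_mul (k 0) (x 0)
      simpa using this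
    have e1 : ∀ z : Fin 1 → ℝ, (Fin.cons s z : Fin (1 + 1) → ℝ) 1 = z 0 := fun _ => rfl
    simp only [Fin.tail_cons, Fin.cons_zero, e1, ha₀, ha₁, hW, Pi.add_apply, h1,
      Fin.sum_univ_one]
    ring
  · have e1 : (Fin.cons 0 x : Fin (1 + 1) → ℝ) 1 = x 0 := rfl
    have e2 : (fun _ => x 0) = x := funext fun i => by rw [Subsingleton.elim i 0]
    simp only [Fin.tail_cons, Fin.cons_zero, e1, hW, hw0, e2]
    ring
  · have e1 : (Fin.cons T x : Fin (1 + 1) → ℝ) 1 = x 0 := rfl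
    have e2 : (fun _ => x 0) = x := funext fun i => by rw [Subsingleton.elim i 0]
    simp only [Fin.tail_cons, Fin.cons_zero, e1, hW, hwT, e2, div_self hT.ne']
    ring
  · simp only [add_sub_cancel]
    rw [hess_comp_plane hWs]
    have hd : Differentiable ℝ w := hw.differentiable (by simp)
    have hF : partialFst W = partialFst w := funext fun ⟨s, y⟩ =>
      partialFst_eq (hWs.differentiable (by simp) _)
        ((hasDerivAt_slice_fst (hd (s, y))).add_const (a 0 * y))
    have hS : partialSnd W = fun q => partialSnd w q + a 0 := funext fun ⟨s, y⟩ =>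
      partialSnd_eq (hWs.differentiable (by simp) _)
        (((hasDerivAt_slice_snd (hd (s, y))).add ((hasDerivAt_id y).const_mul (a 0))).congr_deriv
          (by simp))
    have hFS : partialFst (partialSnd W) = partialFst (partialSnd w) := by
      ext q
      rw [hS, partialFst, fderiv_add_const, partialFst]
    have hSS : partialSnd (partialSnd W) = partialSnd (partialSnd w) := by
      ext q
      rw [hS, partialSnd, fderiv_add_const, partialSnd]
    rw [← partialFst_partialSnd hWs, hFS, hSS, hF]
    obtain ⟨h1, h2⟩ := hweq s hs (x 0)
    refine lagPhase_fin_two_eq ?_ hΘ₁ hΘ₂ h1 h2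
    ext i j
    fin_cases i <;> fin_cases j <;> simp

/-- (Theorem 1.1: solvability of the Dirichlet problem for the special
Lagrangian equation on the cylinder `[0, √τ] × 𝕋ⁿ`.) Let `n ≥ 1` and let
`u₀, u₁ : ℝⁿ → ℝ` be smooth with `∇u₀`, `∇u₁` and `u₁ - u₀` ℤⁿ-periodic. Let
`Θ ∈ [(n-1)π/2, (n+1)π/2)` and assume `ϑ(∇²uᵢ(x)) > Θ - π/2` for all `x` and `i = 0, 1`.
Then for every `τ ∈ (0, 1]` there is a smooth `v^τ : [0, √τ] × ℝⁿ → ℝ`, ℤⁿ-periodic in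
`x`, vanishing on `{0, √τ} × ℝⁿ`, such that setting
`ũ^τ(s, x) = (1 - s/√τ)·u₀(x) + (s/√τ)·u₁(x)` and `w^τ = ũ^τ + v^τ`, the full
`(n+1) × (n+1)` Hessian of `w^τ` in `(s, x)` satisfies
`∑_{j=1}^{n+1} arctan λ_j(D²w^τ(s, x)) = Θ` on the cylinder. -/
theorem stmt15 {n : ℕ} (hn : 1 ≤ n) (u₀ u₁ : (Fin n → ℝ) → ℝ)
    (hu₀ : ContDiff ℝ (⊤ : ℕ∞) u₀) (hu₁ : ContDiff ℝ (⊤ : ℕ∞) u₁)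
    (hper₀ : ∀ (x : Fin n → ℝ) (k : Fin n → ℤ),
      fderiv ℝ u₀ (x + fun j => (k j : ℝ)) = fderiv ℝ u₀ x)
    (hper₁ : ∀ (x : Fin n → ℝ) (k : Fin n → ℤ),
      fderiv ℝ u₁ (x + fun j => (k j : ℝ)) = fderiv ℝ u₁ x)
    (hdiff : ∀ (x : Fin n → ℝ) (k : Fin n → ℤ),
      u₁ (x + fun j => (k j : ℝ)) - u₀ (x + fun j => (k j : ℝ)) = u₁ x - u₀ x)
    (Θ : ℝ) (hΘ₁ : ((n : ℝ) - 1) * Real.pi / 2 ≤ Θ) (hΘ₂ : Θ < ((n : ℝ) + 1) * Real.pi / 2)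
    (hphase₀ : ∀ x, Θ - Real.pi / 2 < lagPhase (hess u₀ x))
    (hphase₁ : ∀ x, Θ - Real.pi / 2 < lagPhase (hess u₁ x)) :
    ∀ τ ∈ Set.Ioc (0 : ℝ) 1,
      ∃ v : (Fin (n + 1) → ℝ) → ℝ, ContDiff ℝ (⊤ : ℕ∞) v ∧
        (∀ (s : ℝ) (x : Fin n → ℝ) (k : Fin n → ℤ),
          v (Fin.cons s (x + fun j => (k j : ℝ))) = v (Fin.cons s x)) ∧
        (∀ x : Fin n → ℝ, v (Fin.cons 0 x) = 0) ∧
        (∀ x : Fin n → ℝ, v (Fin.cons (Real.sqrt τ) x) = 0) ∧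
        (∀ s ∈ Set.Icc (0 : ℝ) (Real.sqrt τ), ∀ x : Fin n → ℝ,
          lagPhase (hess (fun p => (1 - p 0 / Real.sqrt τ) * u₀ (Fin.tail p)
              + (p 0 / Real.sqrt τ) * u₁ (Fin.tail p) + v p) (Fin.cons s x)) = Θ) := by
  obtain ⟨x, hx⟩ := exists_lagPhase_nonpos hu₀ hper₀
  have hΘ := (hphase₀ x).trans_le hx
  have hn2 : (n : ℝ) < 2 := by
    by_contra! h
    nlinarith [Real.pi_pos]
  obtain rfl : n = 1 := by
    have : n < 2 := by exact_mod_cast hn2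
    omega
  intro τ hτ
  exact exists_special_lagrangian_cylinder hu₀ hu₁ hper₀ hdiff (by simpa using hΘ₁)
    (by linarith) hphase₀ hphase₁ (Real.sqrt_pos.2 hτ.1)
end
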